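/- arXiv:math/0304401 — 3 statements merged into one kernel-verified Lean document; each statement's English description precedes it below -/
import Mathlib

section
/- Let p be an odd prime, G a finite p-group, and χ an irreducible complex character of G. If η(χ, χ̄) < 4p−3, then either η(χ, χ̄) = 1 or η(χ, χ̄) = 2p−1. -/
open scoped Classical

/-- The inner product of two class functions on a finite group. -/
noncomputable def charInner (G : Type) [Group G] (φ ψ : G → ℂ) : ℂ :=
  (Nat.card G : ℂ)⁻¹ * ∑ᶠ g : G, φ g * (starRingEnd ℂ) (ψ g)

/-- `χ` is an irreducible complex character of `G`. -/
def IsIrrChar (G : Type) [Group G] (χ : G → ℂ) : Prop :=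
  ∃ V : FDRep ℂ G, CategoryTheory.Simple V ∧ V.character = χ

/-- The complex conjugate of a character. -/
def conjChar {G : Type} (χ : G → ℂ) : G → ℂ := fun g => (starRingEnd ℂ) (χ g)

/-- The set of irreducible constituents of a character `Θ` of `G`. -/
def constituents (G : Type) [Group G] (Θ : G → ℂ) : Set (G → ℂ) :=
  {θ | IsIrrChar G θ ∧ charInner G θ Θ ≠ 0}

/-- `η χ ψ` : the number of distinct irreducible constituents of the product `χ ψ`. -/
noncomputable def eta (G : Type) [Group G] (χ ψ : G → ℂ) : ℕ :=
  (constituents G (χ * ψ)).ncard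

/-- The character of `G` induced from the character `γ` of a subgroup `H`. -/
noncomputable def indChar {G : Type} [Group G] (H : Subgroup G) (γ : ↥H → ℂ) : G → ℂ :=
  fun g => (Nat.card ↥H : ℂ)⁻¹ *
    ∑ᶠ x : G, if h : x * g * x⁻¹ ∈ H then γ ⟨x * g * x⁻¹, h⟩ else 0

/-- Restriction of a character of `G` to a subgroup `M`. -/
def resChar {G : Type} [Group G] (M : Subgroup G) (χ : G → ℂ) : ↥M → ℂ := fun m => χ (m : G)

/-- Restriction of a character of a subgroup `M` to a smaller subgroup `N ≤ M`. -/
def resChar₂ {G : Type} [Group G] {N M : Subgroup G} (h : N ≤ M) (μ : ↥M → ℂ) : ↥N → ℂ :=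
  fun n => μ ⟨n.1, h n.2⟩

/-- The character of `M` induced from the character `ν` of `N`, where `N ≤ M` are
subgroups of `G`. -/
noncomputable def indCharSub {G : Type} [Group G] (N M : Subgroup G) (ν : ↥N → ℂ) : ↥M → ℂ :=
  indChar (N.subgroupOf M) (fun x => ν ⟨x.1.1, x.2⟩)

/-- The inertia group (stabilizer) `G_ν` of a character `ν` of a normal subgroup `N` of `G`. -/
def inertia {G : Type} [Group G] (N : Subgroup G) (hN : N.Normal) (ν : ↥N → ℂ) : Subgroup G where
  carrier := {g : G | ∀ n : ↥N, ν (@MulAut.conjNormal G _ N hN g n) = ν n}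
  one_mem' := by intro n; simp
  mul_mem' := by
    intro a b ha hb n
    rw [map_mul]
    exact (ha _).trans (hb n)
  inv_mem' := by
    intro a ha n
    have h := ha ((@MulAut.conjNormal G _ N hN a)⁻¹ n)
    rw [MulAut.apply_inv_self] at h
    rw [map_inv]
    exact h.symm

/-- `M/N` is a chief factor of `G`. -/
structure IsChiefFactor {G : Type} [Group G] (N M : Subgroup G) : Prop where
  normalN : N.Normal
  normalM : M.Normal
  lt : N < M
  max : ∀ K : Subgroup G, K.Normal → N ≤ K → K ≤ M → K = N ∨ K = M

open Representation in
theorem Representation.character_inv_eq_conj {G : Type*} [Group G] [Finite G] {V : Type*}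
    [AddCommGroup V] [Module ℂ V] [FiniteDimensional ℂ V] (ρ : Representation ℂ G V) (g : G) :
    ρ.character g⁻¹ = starRingEnd ℂ (ρ.character g) := by
  classical
  have := Fintype.ofFinite G
  let b := Module.finBasis ℂ V
  let M : G → Matrix (Fin (Module.finrank ℂ V)) (Fin (Module.finrank ℂ V)) ℂ :=
    fun h => LinearMap.toMatrixAlgEquiv b (ρ h)
  have hMul : ∀ h k, M (h * k) = M h * M k := fun h k => by simp [M]
  have hOne : M 1 = 1 := by simp [M]
  have htr : ∀ h, ρ.character h = (M h).trace := fun h =>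
    LinearMap.trace_eq_matrix_trace ℂ b (ρ h)
  let H := ∑ h : G, (M h).conjTranspose * M h
  have hH : IsUnit H := by
    open scoped ComplexOrder in
    refine Matrix.PosDef.isUnit ?_
    have h1 : H = (M 1).conjTranspose * M 1 +
        ∑ h ∈ Finset.univ.erase 1, (M h).conjTranspose * M h :=
      (Finset.add_sum_erase _ _ (Finset.mem_univ 1)).symm
    rw [h1, hOne]
    refine Matrix.PosDef.add_posSemidef ?_ ?_
    · simpa using Matrix.PosDef.one
    · exact Matrix.posSemidef_sum _ fun h _ => Matrix.posSemidef_conjTranspose_mul_self _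
  have hinv : (M g).conjTranspose * H * M g = H := by
    simp only [H, Finset.mul_sum, Finset.sum_mul]
    refine Fintype.sum_equiv (Equiv.mulRight g) _ _ fun h => ?_
    simp [hMul, Matrix.conjTranspose_mul, Matrix.mul_assoc]
  have h2 : H * M g⁻¹ = (M g).conjTranspose * H := by
    conv_lhs => rw [← hinv]
    rw [Matrix.mul_assoc, ← hMul, mul_inv_cancel, hOne, Matrix.mul_one]
  obtain ⟨u, hu⟩ := hH
  have h3 : M g⁻¹ = (↑u⁻¹ : Matrix _ _ ℂ) * ((M g).conjTranspose * H) := by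
    rw [← h2, ← hu, Units.inv_mul_cancel_left]
  rw [htr, htr, h3, Matrix.trace_mul_comm, Matrix.mul_assoc, ← hu, Units.mul_inv, Matrix.mul_one,
    Matrix.trace_conjTranspose]
  rfl

namespace Subrepresentation

variable {G W : Type*} [Group G] [AddCommGroup W] [Module ℂ W] {τ : Representation ℂ G W}

theorem exists_mem_ne_zero {S : Subrepresentation τ} (hS : S ≠ ⊥) : ∃ w ∈ S, w ≠ 0 := by
  by_contra! h
  refine hS (toSubmodule_injective ?_)
  exact (Submodule.eq_bot_iff _).2 h

theorem ne_bot_of_mem {S : Subrepresentation τ} {w : W} (hw : w ∈ S) (h0 : w ≠ 0) : S ≠ ⊥ := by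
  rintro rfl
  exact h0 ((Submodule.mem_bot ℂ).1 hw)

/-- The image of a subrepresentation of a subrepresentation. -/
def ofSub (U : Subrepresentation τ) (S : Subrepresentation U.toRepresentation) :
    Subrepresentation τ where
  toSubmodule := S.toSubmodule.map U.toSubmodule.subtype
  apply_mem_toSubmodule := by
    rintro g _ ⟨v, hv, rfl⟩
    exact ⟨U.toRepresentation g v, S.apply_mem_toSubmodule g hv, rfl⟩

theorem isIrreducible_of_isAtom {U : Subrepresentation τ} (hU : IsAtom U) :
    U.toRepresentation.IsIrreducible where
  exists_pair_ne := by
    refine ⟨⊥, ⊤, fun h => ?_⟩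
    obtain ⟨w, hw, h0⟩ := exists_mem_ne_zero hU.1
    have : (⟨w, hw⟩ : U.toSubmodule) ∈ (⊤ : Subrepresentation U.toRepresentation) :=
      Submodule.mem_top (R := ℂ)
    rw [← h] at this
    exact h0 (congrArg Subtype.val ((Submodule.mem_bot ℂ).1 this))
  eq_bot_or_eq_top S := by
    have hle : U.ofSub S ≤ U := by
      rintro _ ⟨v, -, rfl⟩
      exact v.2
    rcases hle.eq_or_lt with h | h
    · right
      refine toSubmodule_injective (eq_top_iff.2 ?_)
      rintro v -
      have hv : (v : W) ∈ U.ofSub S := by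
        rw [h]
        exact v.2
      obtain ⟨v', hv', he⟩ := hv
      rwa [← Subtype.ext he]
    · left
      have h0 := hU.2 _ h
      refine toSubmodule_injective ((Submodule.eq_bot_iff _).2 fun v hv => ?_)
      have hv' : (v : W) ∈ U.ofSub S := ⟨v, hv, rfl⟩
      rw [h0] at hv'
      exact Subtype.ext ((Submodule.mem_bot ℂ).1 hv')

theorem exists_isAtom_le [FiniteDimensional ℂ W] {S : Subrepresentation τ} (hS : S ≠ ⊥) :
    ∃ U ≤ S, IsAtom U := by
  induction h : Module.finrank ℂ S.toSubmodule using Nat.strong_induction_on generalizing S with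
  | _ n ih =>
    by_cases hA : IsAtom S
    · exact ⟨S, le_rfl, hA⟩
    · simp only [IsAtom, not_and, not_forall] at hA
      obtain ⟨T, hT, hT0⟩ := hA hS
      have hlt : Module.finrank ℂ T.toSubmodule < n := by
        rw [← h]
        exact Submodule.finrank_lt_finrank_of_lt hT
      obtain ⟨U, hU, hUA⟩ := ih _ hlt hT0 rfl
      exact ⟨U, hU.trans hT.le, hUA⟩

/-- The inclusion of a subrepresentation. -/
def incl (U : Subrepresentation τ) : Representation.IntertwiningMap U.toRepresentation τ where
  toLinearMap := U.toSubmodule.subtype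
  isIntertwining' _ := rfl

end Subrepresentation

section Constituents

open Representation

variable {G : Type} [Group G] [Finite G]

theorem isIrrChar_character {W : Type} [AddCommGroup W] [Module ℂ W] [FiniteDimensional ℂ W]
    (σ : Representation ℂ G W) [σ.IsIrreducible] : IsIrrChar G σ.character := by
  have := Fintype.ofFinite G
  have hinv := invertibleOfNonzero (NeZero.ne (Nat.card G : ℂ))
  refine ⟨FDRep.of σ, ?_, rfl⟩
  rw [FDRep.simple_iff_char_is_norm_one]
  have h := char_orthonormal σ σ
  rw [if_pos ⟨.refl σ⟩, inv_mul_eq_one₀ (NeZero.ne _)] at h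
  exact h.symm

theorem finrank_intertwiningMap_comm {V W : Type*} [AddCommGroup V] [Module ℂ V]
    [FiniteDimensional ℂ V] [AddCommGroup W] [Module ℂ W] [FiniteDimensional ℂ W]
    (τ : Representation ℂ G V) (σ : Representation ℂ G W) :
    Module.finrank ℂ (τ.IntertwiningMap σ) = Module.finrank ℂ (σ.IntertwiningMap τ) := by
  have := Fintype.ofFinite G
  have hinv := invertibleOfNonzero (NeZero.ne (Nat.card G : ℂ))
  have h : (Module.finrank ℂ (τ.IntertwiningMap σ) : ℂ) =
      Module.finrank ℂ (σ.IntertwiningMap τ) := by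
    rw [← card_inv_mul_sum_char_mul_char_eq_finrank, ← card_inv_mul_sum_char_mul_char_eq_finrank]
    congr 1
    exact Fintype.sum_equiv (Equiv.inv G) _ _ fun g => by simp [mul_comm]
  exact_mod_cast h

omit [Finite G] in
theorem finrank_intertwiningMap_ne_zero {V W : Type*} [AddCommGroup V] [Module ℂ V]
    [FiniteDimensional ℂ V] [AddCommGroup W] [Module ℂ W] [FiniteDimensional ℂ W]
    {τ : Representation ℂ G V} {σ : Representation ℂ G W} {f : τ.IntertwiningMap σ} (hf : f ≠ 0) :
    Module.finrank ℂ (τ.IntertwiningMap σ) ≠ 0 := by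
  have : FiniteDimensional ℂ (τ.IntertwiningMap σ) :=
    .of_injective (V₂ := V →ₗ[ℂ] W)
      { toFun := IntertwiningMap.toLinearMap
        map_add' := fun _ _ => rfl
        map_smul' := fun _ _ => rfl } (IntertwiningMap.toLinearMap_injective τ σ)
  exact (Module.finrank_pos_iff_exists_ne_zero.2 ⟨f, hf⟩).ne'

theorem IsIrrChar.exists_isIrreducible {θ : G → ℂ} (hθ : IsIrrChar G θ) :
    ∃ (W : Type) (_ : AddCommGroup W) (_ : Module ℂ W) (_ : FiniteDimensional ℂ W)
      (σ : Representation ℂ G W), σ.IsIrreducible ∧ σ.character = θ := by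
  have := Fintype.ofFinite G
  have hinv := invertibleOfNonzero (NeZero.ne (Nat.card G : ℂ))
  obtain ⟨V, hV, rfl⟩ := hθ
  let σ : Representation ℂ G V := V.ρ
  refine ⟨V, inferInstance, inferInstance, inferInstance, σ, ?_, rfl⟩
  have hbot : (⊤ : Subrepresentation σ) ≠ ⊥ := by
    intro h
    have hsub : ∀ v : V, v = 0 := fun v => by
      have hv : v ∈ (⊤ : Subrepresentation σ) := Submodule.mem_top (R := ℂ)
      rw [h] at hv
      exact (Submodule.mem_bot ℂ).1 hv
    have hzero : ∀ g, V.character g = 0 := fun g => by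
      have : V.ρ g = 0 := LinearMap.ext fun v => hsub _
      simp [FDRep.character, this]
    have h1 := V.simple_iff_char_is_norm_one.1 hV
    simp only [hzero, mul_zero, Finset.sum_const_zero] at h1
    exact NeZero.ne _ h1.symm
  obtain ⟨U, -, hU⟩ := Subrepresentation.exists_isAtom_le hbot
  have := Subrepresentation.isIrreducible_of_isAtom hU
  obtain ⟨U', hU', hchar⟩ := isIrrChar_character U.toRepresentation
  have hincl : U.incl ≠ 0 := fun h => by
    obtain ⟨w, hw, h0⟩ := Subrepresentation.exists_mem_ne_zero hU.1
    exact h0 (DFunLike.congr_fun h (⟨w, hw⟩ : U.toSubmodule))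
  have h1 := finrank_intertwiningMap_ne_zero hincl
  have h2 := card_inv_mul_sum_char_mul_char_eq_finrank U.toRepresentation σ
  have h3 := FDRep.char_orthonormal V U'
  rw [hchar] at h3
  have hiso : Nonempty (V ≅ U') := by
    by_contra hne
    rw [if_neg hne] at h3
    refine h1 ?_
    have := h2.symm.trans h3
    exact_mod_cast this
  have hdim : Module.finrank ℂ V = Module.finrank ℂ U.toSubmodule := by
    have h4 := congrFun (FDRep.char_iso hiso.some) 1
    rw [hchar, FDRep.char_one, char_one] at h4
    exact_mod_cast h4
  have htop : U = ⊤ := Subrepresentation.toSubmodule_injective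
    (Submodule.eq_top_of_finrank_eq hdim.symm)
  exact isSimpleOrder_iff_isAtom_top.2 (htop ▸ hU)

theorem linearIndependent_irrChar :
    LinearIndependent ℂ (fun θ : {θ : G → ℂ // IsIrrChar G θ} => (θ : G → ℂ)) := by
  have := Fintype.ofFinite G
  have hinv := invertibleOfNonzero (NeZero.ne (Nat.card G : ℂ))
  rw [linearIndependent_iff']
  intro s c hc i hi
  obtain ⟨W, _, _, _, σ, hσ, hσi⟩ := i.2.exists_isIrreducible
  have hortho : ∀ j ∈ s, j ≠ i →
      (Nat.card G : ℂ)⁻¹ * ∑ g : G, (j : G → ℂ) g * σ.character g⁻¹ = 0 := by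
    intro j _ hji
    obtain ⟨W', _, _, _, σ', hσ', hσj⟩ := j.2.exists_isIrreducible
    rw [← hσj, char_orthonormal, if_neg]
    rintro ⟨e⟩
    exact hji (Subtype.ext (hσj.symm.trans ((char_iso e).symm.trans hσi)))
  have hnorm : (Nat.card G : ℂ)⁻¹ * ∑ g : G, (i : G → ℂ) g * σ.character g⁻¹ = 1 := by
    rw [← hσi, char_orthonormal, if_pos ⟨.refl σ⟩]
  have h0 : ∑ j ∈ s, c j * ((Nat.card G : ℂ)⁻¹ * ∑ g : G, (j : G → ℂ) g * σ.character g⁻¹) =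
      0 := by
    have h1 : ∀ g : G, ∑ j ∈ s, c j * (j : G → ℂ) g = 0 := fun g => by
      simpa using congrFun hc g
    calc _ = (Nat.card G : ℂ)⁻¹ *
          ∑ g : G, (∑ j ∈ s, c j * (j : G → ℂ) g) * σ.character g⁻¹ := by
          simp_rw [Finset.mul_sum, Finset.sum_mul, Finset.mul_sum]
          rw [Finset.sum_comm]
          exact Finset.sum_congr rfl fun _ _ => Finset.sum_congr rfl fun _ _ => by ring
      _ = 0 := by simp [h1]
  rw [Finset.sum_eq_single i (fun j hj hji => by rw [hortho j hj hji, mul_zero])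
    (fun h => absurd hi h), hnorm, mul_one] at h0
  exact h0

theorem finite_constituents (Θ : G → ℂ) : (constituents G Θ).Finite := by
  have : Finite {θ : G → ℂ // IsIrrChar G θ} := linearIndependent_irrChar.finite
  exact Set.Finite.subset (s := {θ : G → ℂ | IsIrrChar G θ}) (Set.finite_coe_iff.1 this)
    fun θ hθ => hθ.1

theorem character_mem_constituents_iff {V W : Type} [AddCommGroup V] [Module ℂ V]
    [FiniteDimensional ℂ V] [AddCommGroup W] [Module ℂ W] [FiniteDimensional ℂ W]
    (ρ : Representation ℂ G V) (σ : Representation ℂ G W) [σ.IsIrreducible] :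
    σ.character ∈ constituents G (ρ.character * conjChar ρ.character) ↔
      Module.finrank ℂ ((linHom ρ ρ).IntertwiningMap σ) ≠ 0 := by
  have := Fintype.ofFinite G
  have hinv := invertibleOfNonzero (NeZero.ne (Nat.card G : ℂ))
  have h : charInner G σ.character (ρ.character * conjChar ρ.character) =
      Module.finrank ℂ ((linHom ρ ρ).IntertwiningMap σ) := by
    rw [← card_inv_mul_sum_char_mul_char_eq_finrank, charInner, finsum_eq_sum_of_fintype]
    congr 1
    refine Finset.sum_congr rfl fun g _ => ?_
    rw [char_linHom, Pi.mul_apply, map_mul, conjChar, Complex.conj_conj, inv_inv,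
      character_inv_eq_conj, mul_comm (starRingEnd ℂ _)]
  simp [constituents, h, isIrrChar_character]

theorem card_le_eta {V : Type} [AddCommGroup V] [Module ℂ V] [FiniteDimensional ℂ V]
    (ρ : Representation ℂ G V) {ι : Type*} [Fintype ι] (F : ι → Subrepresentation (linHom ρ ρ))
    (hF : ∀ i, F i ≠ ⊥)
    (hsep : ∀ i j, i ≠ j → ∃ (g : G) (a b : ℂ), a ≠ b ∧ (∀ T ∈ F i, linHom ρ ρ g T = a • T) ∧
      ∀ T ∈ F j, linHom ρ ρ g T = b • T) :
    Fintype.card ι ≤ eta G ρ.character (conjChar ρ.character) := by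
  choose U hUF hU using fun i => Subrepresentation.exists_isAtom_le (hF i)
  have hirr := fun i => Subrepresentation.isIrreducible_of_isAtom (hU i)
  have hscalar : ∀ i (g : G) (a : ℂ), (∀ T ∈ F i, linHom ρ ρ g T = a • T) →
      (U i).toRepresentation.character g = a * (U i).toRepresentation.character 1 := by
    intro i g a h
    have : (U i).toRepresentation g = a • (U i).toRepresentation 1 := by
      refine LinearMap.ext fun T => Subtype.ext ?_
      rw [map_one]
      exact h T (hUF i T.2)
    simp only [character]
    rw [this, map_smul, smul_eq_mul]
  have hne : ∀ i, (U i).toRepresentation.character 1 ≠ 0 := by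
    intro i
    obtain ⟨T, hT, h0⟩ := Subrepresentation.exists_mem_ne_zero (hU i).1
    have : Nontrivial (U i).toSubmodule := ⟨⟨T, hT⟩, 0, fun h => h0 (congrArg Subtype.val h)⟩
    rw [char_one]
    exact_mod_cast (Module.finrank_pos (R := ℂ) (M := (U i).toSubmodule)).ne'
  have hinj : Function.Injective fun i => (U i).toRepresentation.character := by
    intro i j hij
    by_contra hne'
    obtain ⟨g, a, b, hab, ha, hb⟩ := hsep i j hne'
    have h1 := hscalar i g a ha
    have h2 := hscalar j g b hb
    simp only at hij
    rw [hij] at h1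
    exact hab (mul_right_cancel₀ (hne j) (h1.symm.trans h2))
  have hmem : ∀ i, (U i).toRepresentation.character ∈
      constituents G (ρ.character * conjChar ρ.character) := by
    intro i
    rw [character_mem_constituents_iff, finrank_intertwiningMap_comm]
    refine finrank_intertwiningMap_ne_zero (f := (U i).incl) fun h => ?_
    obtain ⟨T, hT, h0⟩ := Subrepresentation.exists_mem_ne_zero (hU i).1
    exact h0 (DFunLike.congr_fun h (⟨T, hT⟩ : (U i).toSubmodule))
  rw [eta, ← Nat.card_eq_fintype_card, ← Set.ncard_univ, ← Set.ncard_image_of_injective _ hinj]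
  refine Set.ncard_le_ncard ?_ (finite_constituents _)
  rintro _ ⟨i, -, rfl⟩
  exact hmem i

theorem eta_le_card {V : Type} [AddCommGroup V] [Module ℂ V] [FiniteDimensional ℂ V]
    (ρ : Representation ℂ G V) {ι : Type*} [Fintype ι] (F : ι → Subrepresentation (linHom ρ ρ))
    (hF : ∀ i, IsAtom (F i)) (hsup : ⨆ i, (F i).toSubmodule = ⊤) :
    eta G ρ.character (conjChar ρ.character) ≤ Fintype.card ι := by
  have hirr := fun i => Subrepresentation.isIrreducible_of_isAtom (hF i)
  rw [eta, ← Nat.card_eq_fintype_card, ← Set.ncard_univ]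
  refine (Set.ncard_le_ncard (t := Set.range fun i => (F i).toRepresentation.character) ?_
    (Set.finite_range _)).trans ?_
  · intro θ hθ
    obtain ⟨W, _, _, _, σ, hσ, rfl⟩ := hθ.1.exists_isIrreducible
    rw [character_mem_constituents_iff] at hθ
    obtain ⟨f, hf⟩ : ∃ f : (linHom ρ ρ).IntertwiningMap σ, f ≠ 0 := by
      by_contra! h
      have : Subsingleton ((linHom ρ ρ).IntertwiningMap σ) := ⟨fun a b => (h a).trans (h b).symm⟩
      exact hθ Module.finrank_zero_of_subsingleton
    have : ∃ i, f.comp (F i).incl ≠ 0 := by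
      by_contra! h
      refine hf (IntertwiningMap.ext (LinearMap.ker_eq_top.1 (eq_top_iff.2 ?_)))
      rw [← hsup, iSup_le_iff]
      intro i T hT
      exact DFunLike.congr_fun (h i) (⟨T, hT⟩ : (F i).toSubmodule)
    obtain ⟨i, hi⟩ := this
    refine ⟨i, ?_⟩
    have hb := (IsIrreducible.bijective_or_eq_zero (f.comp (F i).incl)).resolve_right hi
    exact char_iso ((f.comp (F i).incl).ofBijective hb)
  · rw [← Set.image_univ]
    exact Set.ncard_image_le

end Constituents

section EndomorphismRepresentation

open Representation

variable {G : Type} [Group G] {V : Type} [AddCommGroup V] [Module ℂ V]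
  {ρ : Representation ℂ G V}

theorem linHom_self_apply (g : G) (T : Module.End ℂ V) : linHom ρ ρ g T = ρ g * T * ρ g⁻¹ := rfl

theorem rep_mul_rep_inv (g : G) : ρ g * ρ g⁻¹ = 1 := by
  rw [← map_mul, mul_inv_cancel, map_one]

theorem rep_inv_mul_rep (g : G) : ρ g⁻¹ * ρ g = 1 := by
  rw [← map_mul, inv_mul_cancel, map_one]

theorem linHom_self_mul (g : G) (S T : Module.End ℂ V) :
    linHom ρ ρ g (S * T) = linHom ρ ρ g S * linHom ρ ρ g T := by
  simp only [linHom_self_apply]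
  calc ρ g * (S * T) * ρ g⁻¹ = ρ g * S * 1 * T * ρ g⁻¹ := by simp only [mul_assoc, one_mul]
    _ = _ := by rw [← rep_inv_mul_rep (ρ := ρ) g]; simp only [mul_assoc]

theorem linHom_self_one (g : G) : linHom ρ ρ g (1 : Module.End ℂ V) = 1 := by
  rw [linHom_self_apply, mul_one, rep_mul_rep_inv]

theorem linHom_self_pow (g : G) (T : Module.End ℂ V) (n : ℕ) :
    linHom ρ ρ g (T ^ n) = linHom ρ ρ g T ^ n := by
  induction n with
  | zero => rw [pow_zero, pow_zero, linHom_self_one]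
  | succ n ih => rw [pow_succ, pow_succ, linHom_self_mul, ih]

theorem linHom_self_rep (g x : G) : linHom ρ ρ g (ρ x) = ρ (g * x * g⁻¹) := by
  rw [linHom_self_apply, map_mul, map_mul]

theorem linHom_self_eq_smul_iff (g : G) (T : Module.End ℂ V) (a : ℂ) :
    linHom ρ ρ g T = a • T ↔ ρ g * T = a • (T * ρ g) := by
  rw [linHom_self_apply, ← smul_mul_assoc]
  constructor <;> intro h
  · rw [← h, mul_assoc, rep_inv_mul_rep, mul_one]
  · rw [h, mul_assoc, rep_mul_rep_inv, mul_one]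

theorem linHom_self_eq_iff (g : G) (T : Module.End ℂ V) :
    linHom ρ ρ g T = T ↔ ρ g * T = T * ρ g := by
  simpa only [one_smul] using linHom_self_eq_smul_iff (ρ := ρ) g T 1

theorem linHom_self_rep_swap {g x : G} {a : ℂ} (h : linHom ρ ρ g (ρ x) = a • ρ x) :
    linHom ρ ρ x (ρ g) = a⁻¹ • ρ g := by
  rw [linHom_self_eq_smul_iff] at h ⊢
  rcases eq_or_ne a 0 with rfl | ha
  · rw [zero_smul, ← map_mul] at h
    rw [inv_zero, zero_smul, ← map_mul]
    have : (1 : Module.End ℂ V) = 0 := by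
      rw [← rep_mul_rep_inv (ρ := ρ) (g * x), h, zero_mul]
    rw [← mul_one (ρ (x * g)), this, mul_zero]
  · rw [h, smul_smul, inv_mul_cancel₀ ha, one_smul]

theorem linHom_self_rep_swap_of_fixed {g x : G} (h : linHom ρ ρ g (ρ x) = ρ x) :
    linHom ρ ρ x (ρ g) = ρ g := by
  rw [linHom_self_eq_iff] at h ⊢
  exact h.symm

theorem rep_ne_zero [Nontrivial V] (g : G) : ρ g ≠ 0 := by
  intro h
  have := rep_mul_rep_inv (ρ := ρ) g
  rw [h, zero_mul] at this
  exact zero_ne_one this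

theorem nontrivial_of_isIrreducible [hρ : ρ.IsIrreducible] : Nontrivial V := by
  by_contra h
  rw [not_nontrivial_iff_subsingleton] at h
  obtain ⟨A, B, hAB⟩ := hρ.exists_pair_ne
  exact hAB (Subrepresentation.toSubmodule_injective (Subsingleton.elim _ _))

variable [FiniteDimensional ℂ V] [ρ.IsIrreducible]

theorem exists_eq_smul_one_of_linHom_fixed {T : Module.End ℂ V}
    (h : ∀ g, linHom ρ ρ g T = T) : ∃ c : ℂ, T = c • 1 := by
  obtain ⟨c, hc⟩ := (IsIrreducible.algebraMap_intertwiningMap_bijective_of_isAlgClosed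
    (ρ := ρ)).2 ⟨T, fun g => ((linHom_self_eq_iff g T).1 (h g)).symm⟩
  refine ⟨c, LinearMap.ext fun v => ?_⟩
  exact (DFunLike.congr_fun hc v).symm

theorem span_range_rep : Submodule.span ℂ (Set.range ρ) = ⊤ := by
  rw [eq_top_iff]
  rintro T -
  let f : Module.End (Module.End (MonoidAlgebra ℂ G) ρ.asModule) ρ.asModule :=
    { toFun := T
      map_add' := T.map_add
      map_smul' := fun r m => by
        obtain ⟨c, rfl⟩ := (IsSimpleModule.algebraMap_end_bijective_of_isAlgClosed
          (A := MonoidAlgebra ℂ G) (V := ρ.asModule) ℂ).2 r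
        exact T.map_smul c m }
  obtain ⟨r, hr⟩ := jacobson_density f (Finset.univ.image (Module.finBasis ℂ V))
  have : T = ρ.asAlgebraHom r := by
    refine (Module.finBasis ℂ V).ext fun i => ?_
    exact hr _ (Finset.mem_image_of_mem _ (Finset.mem_univ i))
  rw [this, asAlgebraHom_def, MonoidAlgebra.lift_apply]
  exact Submodule.sum_mem _ fun g _ => Submodule.smul_mem _ _ (Submodule.subset_span ⟨g, rfl⟩)

end EndomorphismRepresentation

section PGroupAndEigenspaces

open scoped commutatorElement

theorem IsPGroup.exists_mem_commutator_mem {p : ℕ} [Fact p.Prime] {G : Type*} [Group G] [Finite G]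
    (hG : IsPGroup p G) (K L : Subgroup G) [K.Normal] [L.Normal] (hKL : ¬ L ≤ K) :
    ∃ x ∈ L, x ∉ K ∧ (∀ h, ⁅x, h⁆ ∈ K) ∧ x ^ p ∈ K := by
  let N : Subgroup (G ⧸ K) := L.map (QuotientGroup.mk' K)
  have hN : N.Normal := Subgroup.Normal.map inferInstance _ (QuotientGroup.mk'_surjective K)
  have hQ : IsPGroup p (G ⧸ K) := hG.to_quotient K
  obtain ⟨l, hl, hlK⟩ := SetLike.not_le_iff_exists.1 hKL
  have hnt : Nontrivial N := by
    refine ⟨⟨⟨QuotientGroup.mk' K l, l, hl, rfl⟩, 1, fun h => hlK ?_⟩⟩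
    exact (QuotientGroup.eq_one_iff l).1 (congrArg Subtype.val h)
  have hdvd : p ∣ Nat.card N := by
    obtain ⟨n, hn0, hn⟩ := (hQ.to_subgroup N).nontrivial_iff_card.1 hnt
    rw [hn]
    exact dvd_pow_self _ hn0.ne'
  obtain ⟨b, hb, hb1⟩ := (hQ.of_equiv ConjAct.toConjAct).exists_fixed_point_of_prime_dvd_card_of_fixed_point
    N hdvd (a := 1) (fun g => Subtype.ext (by simp))
  have hbc : (b : G ⧸ K) ∈ N ⊓ Subgroup.center (G ⧸ K) := by
    refine ⟨b.2, Subgroup.mem_center_iff.2 fun q => ?_⟩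
    have := congrArg Subtype.val (hb (ConjAct.toConjAct q))
    rw [ConjAct.Subgroup.val_conj_smul, ConjAct.toConjAct_smul] at this
    exact mul_inv_eq_iff_eq_mul.1 this
  have hnt' : Nontrivial (N ⊓ Subgroup.center (G ⧸ K) : Subgroup _) :=
    ⟨⟨⟨b, hbc⟩, 1, fun h => hb1 (Subtype.ext (congrArg Subtype.val h).symm)⟩⟩
  have hdvd' : p ∣ Nat.card (N ⊓ Subgroup.center (G ⧸ K) : Subgroup _) := by
    obtain ⟨n, hn0, hn⟩ := (hQ.to_subgroup (N ⊓ Subgroup.center (G ⧸ K))).nontrivial_iff_card.1 hnt'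
    rw [hn]
    exact dvd_pow_self _ hn0.ne'
  obtain ⟨⟨z, ⟨x, hx, hxz⟩, hzc⟩, hz⟩ := exists_prime_orderOf_dvd_card' p hdvd'
  subst hxz
  have hxp : (QuotientGroup.mk' K x) ^ p = 1 := by
    have := hz ▸ pow_orderOf_eq_one
      (⟨QuotientGroup.mk' K x, ⟨x, hx, rfl⟩, hzc⟩ : (N ⊓ Subgroup.center (G ⧸ K) : Subgroup _))
    exact congrArg Subtype.val this
  refine ⟨x, hx, fun hxK => ?_, fun h => ?_, ?_⟩
  · have h1 : (⟨QuotientGroup.mk' K x, ⟨x, hx, rfl⟩, hzc⟩ :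
        (N ⊓ Subgroup.center (G ⧸ K) : Subgroup _)) = 1 :=
      Subtype.ext ((QuotientGroup.eq_one_iff x).2 hxK)
    rw [h1, orderOf_one] at hz
    exact (Fact.out : p.Prime).one_lt.ne hz
  · refine (QuotientGroup.eq_one_iff _).1 ?_
    rw [← QuotientGroup.mk'_apply, map_commutatorElement, commutatorElement_eq_one_iff_mul_comm]
    exact (Subgroup.mem_center_iff.1 hzc _).symm
  · refine (QuotientGroup.eq_one_iff _).1 ?_
    rw [← QuotientGroup.mk'_apply, map_pow, hxp]

variable {G W : Type*} [Group G] [AddCommGroup W] [Module ℂ W] {τ : Representation ℂ G W}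

/-- The subrepresentation of the vectors fixed by a normal subgroup `K` on which an element `k`,
central modulo `K`, acts as the scalar `a`. -/
def eigenSub (τ : Representation ℂ G W) (K : Subgroup G) (hK : K.Normal) (k : G)
    (hk : ∀ h, ⁅k, h⁆ ∈ K) (a : ℂ) : Subrepresentation τ where
  toSubmodule :=
    { carrier := {T | (∀ m ∈ K, τ m T = T) ∧ τ k T = a • T}
      add_mem' := fun {S T} hS hT =>
        ⟨fun m hm => by rw [map_add, hS.1 m hm, hT.1 m hm],
          by rw [map_add, hS.2, hT.2, smul_add]⟩
      zero_mem' := ⟨fun m _ => map_zero _, by rw [map_zero, smul_zero]⟩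
      smul_mem' := fun c T hT =>
        ⟨fun m hm => by rw [map_smul, hT.1 m hm], by rw [map_smul, hT.2, smul_comm]⟩ }
  apply_mem_toSubmodule := fun h T hT => by
    have key : ∀ m ∈ K, τ m (τ h T) = τ h T := fun m hm => by
      have h1 := hT.1 _ (hK.conj_mem m hm h⁻¹)
      rw [← Module.End.mul_apply, ← map_mul]
      conv_rhs => rw [← h1]
      rw [← Module.End.mul_apply, ← map_mul]
      congr 2
      group
    refine ⟨key, ?_⟩
    have h2 : k * h = ⁅k, h⁆ * (h * k) := by
      rw [commutatorElement_def]
      group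
    rw [← Module.End.mul_apply, ← map_mul, h2, map_mul, map_mul, Module.End.mul_apply,
      Module.End.mul_apply, hT.2, map_smul, map_smul, key _ (hk h)]

theorem isAtom_of_forall_mem_span {S : Subrepresentation τ} (hS : S ≠ ⊥) {v : W}
    (hv : ∀ T ∈ S, T ∈ Submodule.span ℂ {v}) : IsAtom S := by
  refine ⟨hS, fun U hU => ?_⟩
  by_contra h0
  obtain ⟨u, hu, hu0⟩ := Subrepresentation.exists_mem_ne_zero h0
  refine hU.not_ge fun T hT => ?_
  obtain ⟨a, rfl⟩ := Submodule.mem_span_singleton.1 (hv T hT)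
  obtain ⟨b, rfl⟩ := Submodule.mem_span_singleton.1 (hv u (hU.le hu))
  have hb : b ≠ 0 := by
    rintro rfl
    exact hu0 (zero_smul _ _)
  have := U.toSubmodule.smul_mem (a * b⁻¹) hu
  rwa [smul_smul, mul_assoc, inv_mul_cancel₀ hb, mul_one] at this

theorem mem_of_eigenvectors_mem {p : ℕ} (hp : p ≠ 0) {ω : ℂ} (hω : IsPrimitiveRoot ω p) {k : G}
    {T : W} (hT : τ (k ^ p) T = T) {U X : Submodule ℂ W} (hX : ∀ S ∈ X, τ k S ∈ X) (hTX : T ∈ X)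
    (h : ∀ j < p, ∀ S ∈ X, τ k S = ω ^ j • S → S ∈ U) : T ∈ U := by
  have hω0 : ω ≠ 0 := hω.ne_zero hp
  let P : ℕ → W := fun j => ∑ i ∈ Finset.range p, (ω⁻¹ ^ (i * j)) • τ (k ^ i) T
  have hiter : ∀ i, τ (k ^ i) T ∈ X := fun i => by
    induction i with
    | zero => simpa using hTX
    | succ i ih =>
      rw [pow_succ', map_mul]
      exact hX _ ih
  have hPX : ∀ j, P j ∈ X := fun j => X.sum_mem fun i _ => X.smul_mem _ (hiter i)
  have hPU : ∀ j < p, P j ∈ U := by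
    intro j hj
    refine h j hj _ (hPX j) ?_
    let f : ℕ → W := fun i => (ω⁻¹ ^ (i * j)) • τ (k ^ i) T
    have hshift : ∑ i ∈ Finset.range p, f (i + 1) = ∑ i ∈ Finset.range p, f i := by
      have h1 := Finset.sum_range_succ f p
      rw [Finset.sum_range_succ'] at h1
      have h2 : f p = f 0 := by
        simp only [f, hT, zero_mul, pow_zero, map_one, Module.End.one_apply, one_smul]
        rw [pow_mul, inv_pow, hω.pow_eq_one, inv_one, one_pow, one_smul]
      rw [h2] at h1
      exact add_right_cancel h1
    change τ k (∑ i ∈ Finset.range p, f i) = ω ^ j • ∑ i ∈ Finset.range p, f i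
    conv_rhs => rw [← hshift]
    rw [map_sum, Finset.smul_sum]
    refine Finset.sum_congr rfl fun i _ => ?_
    simp only [f]
    rw [map_smul, smul_smul, ← Module.End.mul_apply, ← map_mul, ← pow_succ']
    congr 1
    rw [add_mul, one_mul, pow_add, mul_comm (ω ^ j), mul_assoc, inv_pow ω j,
      inv_mul_cancel₀ (pow_ne_zero _ hω0), mul_one]
  have hsum : ∑ j ∈ Finset.range p, P j = (p : ℂ) • T := by
    simp only [P]
    rw [Finset.sum_comm]
    have : ∀ i ∈ Finset.range p, ∑ j ∈ Finset.range p, (ω⁻¹ ^ (i * j)) • τ (k ^ i) T =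
        if i = 0 then (p : ℂ) • T else 0 := by
      intro i hi
      rw [← Finset.sum_smul]
      split_ifs with h0
      · subst h0
        simp
      · have hne : ω⁻¹ ^ i ≠ 1 := by
          rw [inv_pow, ne_eq, inv_eq_one]
          exact hω.pow_ne_one_of_pos_of_lt h0 (Finset.mem_range.1 hi)
        simp_rw [pow_mul]
        rw [geom_sum_eq hne, ← pow_mul, mul_comm, pow_mul, inv_pow, hω.pow_eq_one, inv_one,
          one_pow, sub_self, zero_div, zero_smul]
    rw [Finset.sum_congr rfl this, Finset.sum_ite_eq' (Finset.range p) 0,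
      if_pos (Finset.mem_range.2 (Nat.pos_of_ne_zero hp))]
  have hp' : (p : ℂ) ≠ 0 := by exact_mod_cast hp
  have := U.smul_mem (p : ℂ)⁻¹ (hsum ▸ U.sum_mem fun j hj => hPU j (Finset.mem_range.1 hj))
  rwa [smul_smul, inv_mul_cancel₀ hp', one_smul] at this

end PGroupAndEigenspaces

section Chains

open Representation
open scoped commutatorElement

theorem injOn_pow_of_isPGroup {p : ℕ} (hp : p.Prime) {a : ℂ} {n : ℕ} (ha : a ^ p ^ n = 1)
    (h1 : a ≠ 1) : Set.InjOn (fun i : ℕ => a ^ i) (Set.Iio p) := by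
  obtain ⟨k, -, hk⟩ := (Nat.dvd_prime_pow hp).1 (orderOf_dvd_of_pow_eq_one ha)
  have hk0 : k ≠ 0 := by
    rintro rfl
    exact h1 (orderOf_eq_one_iff.1 (by rw [hk, pow_zero]))
  refine (pow_injOn_Iio_orderOf (x := a)).mono fun i hi => ?_
  rw [Set.mem_Iio, hk]
  exact lt_of_lt_of_le hi (Nat.le_self_pow hk0 p)

variable {G : Type} [Group G] {V : Type} [AddCommGroup V] [Module ℂ V]

/-- The eigenspaces attached to a sequence of normal subgroups `K k`, elements `s k` central modulo
`K k` and scalars `α k`, together with the space of fixed vectors. -/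
def chainFamily (ρ : Representation ℂ G V) (p : ℕ) {m : ℕ} (K : Fin m → Subgroup G)
    (hK : ∀ k, (K k).Normal) (s : Fin m → G) (hs : ∀ k h, ⁅s k, h⁆ ∈ K k) (α : Fin m → ℂ) :
    Option (Fin m × Fin (p - 1)) → Subrepresentation (linHom ρ ρ)
  | none => eigenSub _ ⊤ inferInstance 1 (fun _ => Subgroup.mem_top _) 1
  | some (k, j) => eigenSub _ (K k) (hK k) (s k) (hs k) (α k ^ (j.1 + 1))

variable {ρ : Representation ℂ G V} {p m : ℕ} {K : Fin m → Subgroup G}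
  {hK : ∀ k, (K k).Normal} {s t : Fin m → G} {hs : ∀ k h, ⁅s k, h⁆ ∈ K k} {α : Fin m → ℂ}

theorem mem_chainFamily_none {T : Module.End ℂ V} (h : ∀ g, linHom ρ ρ g T = T) :
    T ∈ chainFamily ρ p K hK s hs α none :=
  ⟨fun g _ => h g, by rw [h, one_smul]⟩

theorem chainFamily_ne_bot [Nontrivial V]
    (hfix : ∀ k, ∀ x ∈ K k, linHom ρ ρ x (ρ (t k)) = ρ (t k))
    (hα : ∀ k, linHom ρ ρ (s k) (ρ (t k)) = α k • ρ (t k)) :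
    ∀ i, chainFamily ρ p K hK s hs α i ≠ ⊥
  | none => Subrepresentation.ne_bot_of_mem
      (mem_chainFamily_none fun g => linHom_self_one g) one_ne_zero
  | some (k, j) => by
    refine Subrepresentation.ne_bot_of_mem (w := ρ (t k ^ (j.1 + 1))) ⟨fun x hx => ?_, ?_⟩
      (rep_ne_zero _)
    · rw [map_pow, linHom_self_pow, hfix k x hx]
    · rw [map_pow, linHom_self_pow, hα, smul_pow]

variable [Finite G]

theorem card_chain_le_eta [FiniteDimensional ℂ V] [Nontrivial V] (hp : p ≠ 0)
    (hK : ∀ k, (K k).Normal) (hs : ∀ k h, ⁅s k, h⁆ ∈ K k) (hsK : ∀ k l, k < l → s k ∈ K l)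
    (hfix : ∀ k, ∀ x ∈ K k, linHom ρ ρ x (ρ (t k)) = ρ (t k))
    (hα : ∀ k, linHom ρ ρ (s k) (ρ (t k)) = α k • ρ (t k))
    (hinj : ∀ k, Set.InjOn (fun i : ℕ => α k ^ i) (Set.Iio p)) :
    m * (p - 1) + 1 ≤ eta G ρ.character (conjChar ρ.character) := by
  have hcard : Fintype.card (Option (Fin m × Fin (p - 1))) = m * (p - 1) + 1 := by simp
  rw [← hcard]
  have hne1 : ∀ k (j : Fin (p - 1)), α k ^ (j.1 + 1) ≠ 1 := fun k j h => by
    have := hinj k (x₁ := j.1 + 1) (x₂ := 0) (Set.mem_Iio.2 (by omega)) (Set.mem_Iio.2 (by omega))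
      (by simpa using h)
    omega
  refine card_le_eta ρ (chainFamily ρ p K hK s hs α) (chainFamily_ne_bot hfix hα) ?_
  rintro (_ | ⟨k, i⟩) (_ | ⟨l, j⟩) hij
  · exact absurd rfl hij
  · exact ⟨s l, 1, _, (hne1 l j).symm,
      fun T hT => by rw [hT.1 _ (Subgroup.mem_top _), one_smul], fun T hT => hT.2⟩
  · exact ⟨s k, _, 1, hne1 k i, fun T hT => hT.2,
      fun T hT => by rw [hT.1 _ (Subgroup.mem_top _), one_smul]⟩
  · rcases lt_trichotomy k l with h | rfl | h
    · exact ⟨s k, _, 1, hne1 k i, fun T hT => hT.2,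
        fun T hT => by rw [hT.1 _ (hsK k l h), one_smul]⟩
    · refine ⟨s k, _, _, fun h => hij ?_, fun T hT => hT.2, fun T hT => hT.2⟩
      have := hinj k (Set.mem_Iio.2 (by omega)) (Set.mem_Iio.2 (by omega)) h
      rw [Fin.ext (Nat.succ_injective this)]
    · exact ⟨s l, 1, _, (hne1 l j).symm,
        fun T hT => by rw [hT.1 _ (hsK l k h), one_smul], fun T hT => hT.2⟩

end Chains

section Fixers

open Representation
open scoped commutatorElement

variable {G W : Type*} [Group G] [AddCommGroup W] [Module ℂ W]

/-- The subgroup of the elements fixing every vector of a set. -/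
def fixer (τ : Representation ℂ G W) (A : Set W) : Subgroup G where
  carrier := {g | ∀ T ∈ A, τ g T = T}
  one_mem' := fun T _ => by rw [map_one, Module.End.one_apply]
  mul_mem' := fun {a b} ha hb T hT => by
    rw [map_mul, Module.End.mul_apply, hb T hT, ha T hT]
  inv_mem' := fun {a} ha T hT => by
    conv_lhs => rw [← ha T hT]
    rw [← Module.End.mul_apply, ← map_mul, inv_mul_cancel, map_one, Module.End.one_apply]

theorem mem_fixer {τ : Representation ℂ G W} {A : Set W} {g : G} :
    g ∈ fixer τ A ↔ ∀ T ∈ A, τ g T = T := Iff.rfl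

theorem fixer_normal {τ : Representation ℂ G W} {A : Set W}
    (hA : ∀ g, ∀ T ∈ A, ∃ a : ℂ, ∃ S ∈ A, τ g T = a • S) : (fixer τ A).Normal where
  conj_mem h hh g := fun T hT => by
    obtain ⟨a, S, hS, he⟩ := hA g⁻¹ T hT
    rw [map_mul, map_mul, Module.End.mul_apply, Module.End.mul_apply, he, map_smul, hh S hS, ← he,
      ← Module.End.mul_apply, ← map_mul, mul_inv_cancel, map_one, Module.End.one_apply]

end Fixers

section CentralPairs

open Representation
open scoped commutatorElement

theorem apply_pow_eq_smul {G W : Type*} [Group G] [AddCommGroup W] [Module ℂ W]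
    {τ : Representation ℂ G W} {g : G} {T : W} {a : ℂ} (h : τ g T = a • T) (n : ℕ) :
    τ (g ^ n) T = a ^ n • T := by
  induction n with
  | zero => rw [pow_zero, pow_zero, map_one, Module.End.one_apply, one_smul]
  | succ n ih =>
    rw [pow_succ, map_mul, Module.End.mul_apply, h, map_smul, ih, smul_smul, pow_succ, mul_comm]

variable {G : Type} [Group G] {V : Type} [AddCommGroup V] [Module ℂ V]

/-- The kernel of the conjugation representation on endomorphisms. -/
abbrev homKer (ρ : Representation ℂ G V) : Subgroup G := fixer (linHom ρ ρ) Set.univ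

/-- The elements of `G` whose image under `ρ` commutes with `ρ y`. -/
abbrev repCentralizer (ρ : Representation ℂ G V) (y : G) : Subgroup G := fixer (linHom ρ ρ) {ρ y}

/-- An element `y`, central of order `p` modulo the kernel of the conjugation representation,
together with an element `g` not commuting with it. -/
structure CentralPair (ρ : Representation ℂ G V) (p : ℕ) (y g : G) (ω : ℂ) : Prop where
  isPrimitiveRoot : IsPrimitiveRoot ω p
  commutator_mem : ∀ h, ⁅y, h⁆ ∈ homKer ρ
  pow_mem : y ^ p ∈ homKer ρ
  apply_rep : linHom ρ ρ g (ρ y) = ω • ρ y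
  exists_apply_rep : ∀ h, ∃ i : ℕ, linHom ρ ρ h (ρ y) = ω ^ i • ρ y

theorem homKer_normal (ρ : Representation ℂ G V) : (homKer ρ).Normal :=
  fixer_normal fun _ _ _ => ⟨1, _, Set.mem_univ _, (one_smul _ _).symm⟩

theorem mem_repCentralizer {ρ : Representation ℂ G V} {y h : G} :
    h ∈ repCentralizer ρ y ↔ linHom ρ ρ h (ρ y) = ρ y := by
  simp only [repCentralizer, mem_fixer, Set.mem_singleton_iff, forall_eq]

variable {ρ : Representation ℂ G V}

theorem rep_smul_cancel [Nontrivial V] {x : G} {a b : ℂ} (h : a • ρ x = b • ρ x) : a = b :=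
  smul_left_injective ℂ (rep_ne_zero x) h

theorem exists_rep_eq_smul_one [FiniteDimensional ℂ V] [ρ.IsIrreducible] {z : G}
    (hz : z ∈ homKer ρ) : ∃ c : ℂ, ρ z = c • 1 :=
  exists_eq_smul_one_of_linHom_fixed fun _ =>
    linHom_self_rep_swap_of_fixed (hz _ (Set.mem_univ _))

theorem mem_homKer_of_rep_eq_smul_one [Nontrivial V] {z : G} {c : ℂ} (h : ρ z = c • 1) :
    z ∈ homKer ρ := fun T _ => by
  rw [linHom_self_eq_iff, h, smul_mul_assoc, mul_smul_comm, one_mul, mul_one]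

theorem exists_centralPair [Finite G] [FiniteDimensional ℂ V] [ρ.IsIrreducible] {p : ℕ}
    (hp : p.Prime) (hG : IsPGroup p G) (hZ : homKer ρ ≠ ⊤) :
    ∃ y g ω, CentralPair ρ p y g ω := by
  have := Fact.mk hp
  have hnt := nontrivial_of_isIrreducible (ρ := ρ)
  have hn := homKer_normal ρ
  obtain ⟨y, -, hyZ, hy, hyp⟩ := hG.exists_mem_commutator_mem (homKer ρ) ⊤
    (fun h => hZ (top_le_iff.1 h))
  have h1 : ∀ h, ∃ a : ℂ, linHom ρ ρ h (ρ y) = a • ρ y := by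
    intro h
    have hm : ⁅h, y⁆ ∈ homKer ρ := by
      rw [← commutatorElement_inv]
      exact inv_mem (hy h)
    obtain ⟨c, hc⟩ := exists_rep_eq_smul_one hm
    refine ⟨c, ?_⟩
    have : h * y * h⁻¹ = ⁅h, y⁆ * y := by
      rw [commutatorElement_def]
      group
    rw [linHom_self_rep, this, map_mul, hc, smul_mul_assoc, one_mul]
  have h2 : ∀ (h : G) (a : ℂ), linHom ρ ρ h (ρ y) = a • ρ y → a ^ p = 1 := by
    intro h a ha
    have h3 : linHom ρ ρ h (ρ (y ^ p)) = ρ (y ^ p) :=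
      linHom_self_rep_swap_of_fixed (hyp _ (Set.mem_univ _))
    have h4 : linHom ρ ρ h (ρ (y ^ p)) = a ^ p • ρ (y ^ p) := by
      rw [map_pow, linHom_self_pow, ha, smul_pow]
    refine rep_smul_cancel (ρ := ρ) (x := y ^ p) ?_
    rw [← h4, h3, one_smul]
  obtain ⟨g, hg⟩ : ∃ g, linHom ρ ρ g (ρ y) ≠ ρ y := by
    by_contra! h
    obtain ⟨c, hc⟩ := exists_eq_smul_one_of_linHom_fixed h
    exact hyZ (mem_homKer_of_rep_eq_smul_one hc)
  obtain ⟨ω, hω⟩ := h1 g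
  have hω1 : ω ≠ 1 := by
    rintro rfl
    exact hg (by rw [hω, one_smul])
  have hprim : IsPrimitiveRoot ω p := by
    rw [← orderOf_eq_prime (h2 g ω hω) hω1]
    exact IsPrimitiveRoot.orderOf ω
  refine ⟨y, g, ω, hprim, hy, hyp, hω, fun h => ?_⟩
  obtain ⟨a, ha⟩ := h1 h
  have : NeZero p := ⟨hp.ne_zero⟩
  obtain ⟨i, -, hi⟩ := hprim.eq_pow_of_pow_eq_one (h2 h a ha)
  exact ⟨i, by rw [ha, hi]⟩

namespace CentralPair

variable {p : ℕ} {y g : G} {ω : ℂ} (h : CentralPair ρ p y g ω)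

include h

theorem normal : (repCentralizer ρ y).Normal := fixer_normal fun k T hT => by
  rw [Set.mem_singleton_iff] at hT
  subst hT
  obtain ⟨i, hi⟩ := h.exists_apply_rep k
  exact ⟨_, _, rfl, hi⟩

omit h in
theorem self_mem : y ∈ repCentralizer ρ y := by
  rw [mem_repCentralizer, linHom_self_rep, mul_inv_cancel_right]

theorem mul_comm_mem (hp : p ≠ 0) (k l : G) : ⁅k, l⁆ ∈ repCentralizer ρ y := by
  obtain ⟨i, hi⟩ := h.exists_apply_rep k
  obtain ⟨j, hj⟩ := h.exists_apply_rep l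
  have h1 : linHom ρ ρ (l * k) (ρ y) = (ω ^ i * ω ^ j) • ρ y := by
    rw [map_mul, Module.End.mul_apply, hi, map_smul, hj, smul_smul]
  have h2 : linHom ρ ρ (k * l) (ρ y) = (ω ^ i * ω ^ j) • ρ y := by
    rw [map_mul, Module.End.mul_apply, hj, map_smul, hi, smul_smul, mul_comm]
  have h3 : k * l = ⁅k, l⁆ * (l * k) := by
    rw [commutatorElement_def]
    group
  rw [h3, map_mul, Module.End.mul_apply, h1, map_smul] at h2
  have h0 := h.isPrimitiveRoot.ne_zero hp
  rw [mem_repCentralizer]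
  exact smul_right_injective _ (mul_ne_zero (pow_ne_zero i h0) (pow_ne_zero j h0)) h2

theorem apply_pow (d : ℕ) : linHom ρ ρ (g ^ d) (ρ y) = ω ^ d • ρ y :=
  apply_pow_eq_smul h.apply_rep d

theorem pow_mem_repCentralizer : g ^ p ∈ repCentralizer ρ y := by
  rw [mem_repCentralizer, h.apply_pow, h.isPrimitiveRoot.pow_eq_one, one_smul]

theorem exists_eq_mul_pow (hp : p ≠ 0) {d : ℕ} (hd : d.Coprime p) (k : G) :
    ∃ c ∈ repCentralizer ρ y, ∃ i : ℕ, k = c * (g ^ d) ^ i := by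
  obtain ⟨j, hj⟩ := h.exists_apply_rep k
  have : NeZero p := ⟨hp⟩
  obtain ⟨i, -, hi⟩ := (h.isPrimitiveRoot.pow_of_coprime d hd).eq_pow_of_pow_eq_one
    (ξ := ω ^ j) (by rw [← pow_mul, mul_comm, pow_mul, h.isPrimitiveRoot.pow_eq_one, one_pow])
  refine ⟨k * ((g ^ d) ^ i)⁻¹, ?_, i, by group⟩
  have h1 : linHom ρ ρ (k * ((g ^ d) ^ i)⁻¹ * (g ^ d) ^ i) (ρ y) = ω ^ j • ρ y := by
    rw [inv_mul_cancel_right, hj]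
  rw [map_mul, Module.End.mul_apply, ← pow_mul, h.apply_pow, map_smul, pow_mul, hi, pow_mul] at h1
  rw [mem_repCentralizer]
  exact smul_right_injective _ (pow_ne_zero j (h.isPrimitiveRoot.ne_zero hp)) h1

theorem eq_smul_one (hp : p ≠ 0) [FiniteDimensional ℂ V] [ρ.IsIrreducible] {T : Module.End ℂ V}
    (hC : ∀ c ∈ repCentralizer ρ y, linHom ρ ρ c T = T) (hg : linHom ρ ρ g T = T) :
    ∃ a : ℂ, T = a • 1 := by
  refine exists_eq_smul_one_of_linHom_fixed (ρ := ρ) fun k => ?_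
  obtain ⟨c, hc, i, rfl⟩ := h.exists_eq_mul_pow hp (d := 1) (Nat.coprime_one_left p) k
  have h1 := apply_pow_eq_smul (τ := linHom ρ ρ) (a := 1) (by rw [hg, one_smul]) i
  rw [pow_one, map_mul, Module.End.mul_apply, h1, one_pow, one_smul, hC c hc]

end CentralPair

end CentralPairs

section NoncommutativeCase

open Representation
open scoped commutatorElement

variable {G : Type} [Group G] {V : Type} [AddCommGroup V] [Module ℂ V] {ρ : Representation ℂ G V}

theorem fixed_of_commutator_mul {c w n x g : G} (hcx : Commute (ρ c) (ρ x))
    (hwc : Commute (ρ w) (ρ c)) (hwn : Commute (ρ w) (ρ n)) (hwx : Commute (ρ w) (ρ x))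
    (hcz : Commute (ρ c) (ρ ⁅n, x⁆)) (hn : g * n * g⁻¹ = c * n) (hx : g * x * g⁻¹ = w * x) :
    linHom ρ ρ g (ρ ⁅n, x⁆) = ρ ⁅n, x⁆ := by
  have key : ∀ {a b : G}, Commute (ρ a) (ρ b) → Commute (ρ.toHomUnits a) (ρ.toHomUnits b) :=
    fun hab => Units.ext hab
  have hcx' := key hcx
  have hwc' := key hwc
  have hwn' := key hwn
  have hwx' := key hwx
  have hcz' := key hcz
  have h1 : g * ⁅n, x⁆ * g⁻¹ = ⁅c * n, w * x⁆ := by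
    rw [← hn, ← hx, commutatorElement_def, commutatorElement_def]
    group
  have h2 : ρ.toHomUnits ⁅c * n, w * x⁆ = ρ.toHomUnits ⁅n, x⁆ := by
    simp only [map_commutatorElement, map_mul] at hcz' ⊢
    generalize ρ.toHomUnits c = c at *
    generalize ρ.toHomUnits n = n at *
    generalize ρ.toHomUnits w = w at *
    generalize ρ.toHomUnits x = x at *
    have h3 : Commute w (c * n) := hwc'.mul_right hwn'
    have h4 : ⁅c * n, w * x⁆ = ⁅c * n, x⁆ := by
      have h5 : Commute w (c * n * x * (c * n)⁻¹ * x⁻¹) :=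
        ((h3.mul_right hwx').mul_right h3.inv_right).mul_right hwx'.inv_right
      calc ⁅c * n, w * x⁆ = c * n * w * (x * (c * n)⁻¹ * x⁻¹ * w⁻¹) := by
            rw [commutatorElement_def]
            group
        _ = w * (c * n * x * (c * n)⁻¹ * x⁻¹) * w⁻¹ := by
            rw [← h3.eq]
            group
        _ = _ := by rw [h5.eq, mul_inv_cancel_right, commutatorElement_def]
    rw [h4]
    calc ⁅c * n, x⁆ = c * n * x * n⁻¹ * (c⁻¹ * x⁻¹) := by
          rw [commutatorElement_def]
          group
      _ = c * n * x * n⁻¹ * (x⁻¹ * c⁻¹) := by rw [(hcx'.inv_inv).eq]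
      _ = c * ⁅n, x⁆ * c⁻¹ := by
          rw [commutatorElement_def]
          group
      _ = ⁅n, x⁆ := by rw [hcz'.eq, mul_inv_cancel_right]
  rw [linHom_self_rep, h1]
  exact congrArg Units.val h2

theorem CentralPair.le_eta_of_not_commute [Finite G] [FiniteDimensional ℂ V] [ρ.IsIrreducible]
    {p : ℕ} (hp : p.Prime) (hG : IsPGroup p G) {y g : G} {ω : ℂ} (h : CentralPair ρ p y g ω)
    (hC : ∃ a ∈ repCentralizer ρ y, ∃ b ∈ repCentralizer ρ y, linHom ρ ρ a (ρ b) ≠ ρ b) :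
    4 * (p - 1) + 1 ≤ eta G ρ.character (conjChar ρ.character) := by
  have := Fact.mk hp
  have hnt := nontrivial_of_isIrreducible (ρ := ρ)
  set C := repCentralizer ρ y with hCdef
  have hCn : C.Normal := h.normal
  let Z' : Subgroup G := fixer (linHom ρ ρ) (ρ '' C)
  have hZ'mem : ∀ {w}, w ∈ Z' ↔ ∀ c ∈ C, linHom ρ ρ w (ρ c) = ρ c := fun {w} => by
    simp only [Z', mem_fixer, Set.forall_mem_image, SetLike.mem_coe]
  have hZ'n : Z'.Normal := fixer_normal fun k T hT => by
    obtain ⟨c, hc, rfl⟩ := hT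
    exact ⟨1, _, ⟨_, hCn.conj_mem c hc k, rfl⟩, by rw [one_smul, linHom_self_rep]⟩
  obtain ⟨x, hxC, hxZ', hx, -⟩ := hG.exists_mem_commutator_mem Z' C fun hle => by
    obtain ⟨a, ha, b, hb, hab⟩ := hC
    exact hab (hZ'mem.1 (hle ha) b hb)
  let A : Set (Module.End ℂ V) := {T | ∃ w ∈ Z', T = ρ (w * x)}
  have hAn : (fixer (linHom ρ ρ) A).Normal := fixer_normal fun k T hT => by
    obtain ⟨w, hw, rfl⟩ := hT
    refine ⟨1, _, ⟨(k * w * k⁻¹) * ⁅k, x⁆, mul_mem (hZ'n.conj_mem w hw k) ?_, rfl⟩, ?_⟩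
    · rw [← commutatorElement_inv]
      exact inv_mem (hx k)
    · rw [one_smul, linHom_self_rep, commutatorElement_def]
      congr 1
      group
  let K : Subgroup G := C ⊓ fixer (linHom ρ ρ) A
  have hKn : K.Normal := Subgroup.normal_inf_normal _ _
  have hKx : ∀ k ∈ K, linHom ρ ρ k (ρ x) = ρ x := fun k hk =>
    hk.2 _ ⟨1, one_mem _, by rw [one_mul]⟩
  have hmemK : ∀ k ∈ C, linHom ρ ρ k (ρ x) = ρ x → k ∈ K := by
    rintro k hk hkx
    refine ⟨hk, ?_⟩
    rintro _ ⟨w, hw, rfl⟩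
    rw [map_mul, linHom_self_mul, hkx, linHom_self_rep_swap_of_fixed (hZ'mem.1 hw k hk)]
  obtain ⟨n, hnC, hnK, hn, -⟩ := hG.exists_mem_commutator_mem K C fun hle =>
    hxZ' (hZ'mem.2 fun c hc => linHom_self_rep_swap_of_fixed (hKx c (hle hc)))
  have hzZ' : ⁅n, x⁆ ∈ Z' := by
    rw [← commutatorElement_inv]
    exact inv_mem (hx n)
  have hcommute : ∀ w ∈ Z', ∀ c ∈ C, Commute (ρ w) (ρ c) := fun w hw c hc =>
    (linHom_self_eq_iff w (ρ c)).1 (hZ'mem.1 hw c hc)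
  obtain ⟨ε, hε⟩ : ∃ ε : ℂ, ρ ⁅n, x⁆ = ε • 1 := by
    refine exists_eq_smul_one_of_linHom_fixed (ρ := ρ) fun k => ?_
    have hcK : ⁅k, n⁆ ∈ K := by
      rw [← commutatorElement_inv]
      exact inv_mem (hn k)
    have hwZ : ⁅k, x⁆ ∈ Z' := by
      rw [← commutatorElement_inv]
      exact inv_mem (hx k)
    refine fixed_of_commutator_mul (c := ⁅k, n⁆) (w := ⁅k, x⁆)
      ((linHom_self_eq_iff _ _).1 (hKx _ hcK)) (hcommute _ hwZ _ hcK.1) (hcommute _ hwZ _ hnC)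
      (hcommute _ hwZ _ hxC) (hcommute _ hzZ' _ hcK.1).symm ?_ ?_
    · rw [commutatorElement_def]
      group
    · rw [commutatorElement_def]
      group
  have hnx : linHom ρ ρ n (ρ x) = ε • ρ x := by
    have : n * x * n⁻¹ = ⁅n, x⁆ * x := by
      rw [commutatorElement_def]
      group
    rw [linHom_self_rep, this, map_mul, hε, smul_mul_assoc, one_mul]
  have hε1 : ε ≠ 1 := by
    rintro rfl
    exact hnK (hmemK n hnC (by rw [hnx, one_smul]))
  obtain ⟨r, hr⟩ : ∃ r, n ^ p ^ r = 1 := hG n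
  have hεr : ε ^ p ^ r = 1 := by
    have := apply_pow_eq_smul hnx (p ^ r)
    rw [hr, map_one, Module.End.one_apply] at this
    exact rep_smul_cancel (ρ := ρ) (x := x) (by rw [← this, one_smul])
  have hinjω : Set.InjOn (fun i : ℕ => ω ^ i) (Set.Iio p) := fun i hi j hj hij =>
    h.isPrimitiveRoot.pow_inj hi hj hij
  have hinjω' : Set.InjOn (fun i : ℕ => ω⁻¹ ^ i) (Set.Iio p) := fun i hi j hj hij =>
    h.isPrimitiveRoot.inv.pow_inj hi hj hij
  have hinjε' : Set.InjOn (fun i : ℕ => ε⁻¹ ^ i) (Set.Iio p) :=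
    injOn_pow_of_isPGroup hp (n := r) (by rw [inv_pow, hεr, inv_one]) (inv_ne_one.2 hε1)
  have hyZ' : y ∈ Z' := hZ'mem.2 fun c hc =>
    linHom_self_rep_swap_of_fixed (mem_repCentralizer.1 hc)
  have hyK : y ∈ K := hmemK y CentralPair.self_mem (hZ'mem.1 hyZ' x hxC)
  have hxK : x ∈ K := hmemK x hxC (by rw [linHom_self_rep, mul_inv_cancel_right])
  refine card_chain_le_eta (ρ := ρ) (m := 4) hp.ne_zero (K := ![homKer ρ, Z', K, C])
    (s := ![y, x, n, g]) (t := ![g, n, x, y]) (α := ![ω⁻¹, ε⁻¹, ε, ω]) ?_ ?_ ?_ ?_ ?_ ?_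
  · intro k
    fin_cases k
    exacts [homKer_normal ρ, hZ'n, hKn, hCn]
  · intro k
    fin_cases k
    exacts [h.commutator_mem, hx, hn, h.mul_comm_mem hp.ne_zero g]
  · intro k l hkl
    fin_cases k <;> fin_cases l
    all_goals first | exact absurd hkl (by decide) | skip
    exacts [hyZ', hyK, CentralPair.self_mem, hxK, hxC, hnC]
  · intro k
    fin_cases k
    exacts [fun _ hx => hx _ (Set.mem_univ _), fun w hw => hZ'mem.1 hw n hnC, hKx,
      fun _ hc => mem_repCentralizer.1 hc]
  · intro k
    fin_cases k
    exacts [linHom_self_rep_swap h.apply_rep, linHom_self_rep_swap hnx, hnx, h.apply_rep]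
  · intro k
    fin_cases k
    exacts [hinjω', hinjε', injOn_pow_of_isPGroup hp hεr hε1, hinjω]

end NoncommutativeCase

section CommutativeCase

open Representation
open scoped commutatorElement

/-- The subspace of the vectors fixed by a subgroup. -/
def fixedSubmodule {G W : Type*} [Group G] [AddCommGroup W] [Module ℂ W]
    (τ : Representation ℂ G W) (C : Subgroup G) : Submodule ℂ W where
  carrier := {T | ∀ c ∈ C, τ c T = T}
  add_mem' := fun {S T} hS hT c hc => by rw [map_add, hS c hc, hT c hc]
  zero_mem' := fun c _ => map_zero _
  smul_mem' := fun a T hT c hc => by rw [map_smul, hT c hc]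

theorem apply_mem_fixedSubmodule {G W : Type*} [Group G] [AddCommGroup W] [Module ℂ W]
    {τ : Representation ℂ G W} {C : Subgroup G} (hC : C.Normal) (g : G) {T : W}
    (hT : T ∈ fixedSubmodule τ C) : τ g T ∈ fixedSubmodule τ C := fun c hc => by
  conv_rhs => rw [← hT _ (hC.conj_mem c hc g⁻¹)]
  rw [← Module.End.mul_apply, ← map_mul, ← Module.End.mul_apply, ← map_mul]
  congr 2
  group

variable {G : Type} [Group G] {V : Type} [AddCommGroup V] [Module ℂ V]

/-- The line spanned by a vector which is an eigenvector of every group element. -/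
def lineSub {W : Type*} [AddCommGroup W] [Module ℂ W] (τ : Representation ℂ G W) (v : W)
    (hv : ∀ g, ∃ a : ℂ, τ g v = a • v) : Subrepresentation τ where
  toSubmodule := Submodule.span ℂ {v}
  apply_mem_toSubmodule := fun g T hT => by
    obtain ⟨b, rfl⟩ := Submodule.mem_span_singleton.1 hT
    obtain ⟨a, ha⟩ := hv g
    exact Submodule.mem_span_singleton.2 ⟨b * a, by rw [map_smul, ha, smul_smul]⟩

variable {ρ : Representation ℂ G V}

theorem mul_rep_cancel {S T : Module.End ℂ V} {x : G} (h : S * ρ x = T * ρ x) : S = T := by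
  rw [← mul_one S, ← mul_one T, ← rep_mul_rep_inv (ρ := ρ) x, ← mul_assoc, ← mul_assoc, h]

theorem linHom_mul_rep_iff {k x : G} {a : ℂ} (ha : a ≠ 0) (hx : linHom ρ ρ k (ρ x) = a • ρ x)
    (T : Module.End ℂ V) : linHom ρ ρ k (T * ρ x) = a • (T * ρ x) ↔ linHom ρ ρ k T = T := by
  rw [linHom_self_mul, hx, mul_smul_comm]
  exact ⟨fun h => mul_rep_cancel (smul_right_injective _ ha h), fun h => by rw [h]⟩

namespace CentralPair

variable {p : ℕ} {y g : G} {ω : ℂ}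

theorem mul_self_le_eta [Finite G] [FiniteDimensional ℂ V] [ρ.IsIrreducible]
    (h : CentralPair ρ p y g ω) (hp : p ≠ 0) {d : ℕ} (hd : d.Coprime p)
    (hC : ∀ c ∈ repCentralizer ρ y, ∃ a : ℂ, linHom ρ ρ c (ρ (g ^ d)) = a • ρ (g ^ d)) :
    p * p ≤ eta G ρ.character (conjChar ρ.character) := by
  have hnt := nontrivial_of_isIrreducible (ρ := ρ)
  have hgd : linHom ρ ρ (g ^ d) (ρ (g ^ d)) = ρ (g ^ d) := by
    rw [linHom_self_rep, mul_inv_cancel_right]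
  have hall : ∀ k, ∃ a : ℂ, linHom ρ ρ k (ρ (g ^ d)) = a • ρ (g ^ d) := by
    intro k
    obtain ⟨c, hc, i, rfl⟩ := h.exists_eq_mul_pow hp hd k
    obtain ⟨a, ha⟩ := hC c hc
    have h1 := apply_pow_eq_smul (τ := linHom ρ ρ) (a := 1) (by rw [hgd, one_smul]) i
    exact ⟨a, by rw [map_mul, Module.End.mul_apply, h1, one_pow, one_smul, ha]⟩
  have hpow : ∀ (k : G) (a b : ℂ) (i j : ℕ), linHom ρ ρ k (ρ y) = a • ρ y →
      linHom ρ ρ k (ρ (g ^ d)) = b • ρ (g ^ d) →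
      linHom ρ ρ k (ρ (y ^ i * (g ^ d) ^ j)) = (a ^ i * b ^ j) • ρ (y ^ i * (g ^ d) ^ j) := by
    intro k a b i j ha hb
    rw [map_mul, map_pow ρ y i, map_pow ρ (g ^ d) j, linHom_self_mul, linHom_self_pow,
      linHom_self_pow, ha, hb, smul_pow, smul_pow, smul_mul_smul_comm]
  let F : Fin p × Fin p → Subrepresentation (linHom ρ ρ) := fun ij =>
    lineSub _ (ρ (y ^ ij.1.1 * (g ^ d) ^ ij.2.1)) fun k => by
      obtain ⟨i, hi⟩ := h.exists_apply_rep k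
      obtain ⟨b, hb⟩ := hall k
      exact ⟨_, hpow k _ b _ _ hi hb⟩
  have hF : ∀ (k : G) (a b : ℂ), linHom ρ ρ k (ρ y) = a • ρ y →
      linHom ρ ρ k (ρ (g ^ d)) = b • ρ (g ^ d) → ∀ ij, ∀ T ∈ F ij,
      linHom ρ ρ k T = (a ^ ij.1.1 * b ^ ij.2.1) • T := by
    intro k a b ha hb ij T hT
    obtain ⟨c, rfl⟩ := Submodule.mem_span_singleton.1 hT
    rw [map_smul, hpow k a b _ _ ha hb, smul_comm]
  have hprim := h.isPrimitiveRoot.pow_of_coprime d hd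
  have h1 := hF (g ^ d) (ω ^ d) 1 (h.apply_pow d) (by rw [hgd, one_smul])
  have h2 := hF y 1 (ω ^ d)⁻¹ (by rw [linHom_self_rep, mul_inv_cancel_right, one_smul])
    (linHom_self_rep_swap (h.apply_pow d))
  have hcard : Fintype.card (Fin p × Fin p) = p * p := by simp
  rw [← hcard]
  refine card_le_eta ρ F (fun ij => Subrepresentation.ne_bot_of_mem
    (Submodule.mem_span_singleton_self _) (rep_ne_zero _)) ?_
  rintro ⟨i, j⟩ ⟨i', j'⟩ hne
  by_cases hi : i = i'
  · refine ⟨y, _, _, fun he => hne ?_, h2 _, h2 _⟩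
    simp only [one_pow, one_mul] at he
    rw [hi, Fin.ext (hprim.inv.pow_inj j.2 j'.2 he)]
  · refine ⟨g ^ d, _, _, fun he => hi ?_, h1 _, h1 _⟩
    simp only [one_pow, mul_one] at he
    exact Fin.ext (hprim.pow_inj i.2 i'.2 he)

variable [FiniteDimensional ℂ V] [ρ.IsIrreducible] (h : CentralPair ρ p y g ω) (hp : p ≠ 0)
  (hcomm : ∀ a ∈ repCentralizer ρ y, ∀ b ∈ repCentralizer ρ y, linHom ρ ρ a (ρ b) = ρ b)

include h hp hcomm

theorem mem_fixedSubmodule_of_apply_self {T : Module.End ℂ V} (hT : linHom ρ ρ y T = T) :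
    T ∈ fixedSubmodule (linHom ρ ρ) (repCentralizer ρ y) := by
  let P : Module.End ℂ (V →ₗ[ℂ] V) := ∑ i ∈ Finset.range p, linHom ρ ρ (y ^ i)
  have hPeig : ∀ (S : Module.End ℂ V) (a : ℂ), linHom ρ ρ y S = a • S →
      P S = (∑ i ∈ Finset.range p, a ^ i) • S := by
    intro S a hS
    simp only [P, LinearMap.sum_apply, apply_pow_eq_smul hS, Finset.sum_smul]
  have hspan : Submodule.span ℂ (Set.range ρ) ≤
      (fixedSubmodule (linHom ρ ρ) (repCentralizer ρ y)).comap P := by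
    rw [Submodule.span_le]
    rintro _ ⟨k, rfl⟩
    obtain ⟨i, hi⟩ := h.exists_apply_rep k
    have h1 := linHom_self_rep_swap hi
    rw [SetLike.mem_coe, Submodule.mem_comap, hPeig _ _ h1]
    by_cases hω : ω ^ i = 1
    · have hk : k ∈ repCentralizer ρ y := by rw [mem_repCentralizer, hi, hω, one_smul]
      exact Submodule.smul_mem _ _ fun c hc => hcomm c hc k hk
    · have hne : (ω ^ i)⁻¹ ≠ 1 := inv_ne_one.2 hω
      rw [geom_sum_eq hne, inv_pow, ← pow_mul, mul_comm, pow_mul, h.isPrimitiveRoot.pow_eq_one,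
        one_pow, inv_one, sub_self, zero_div, zero_smul]
      exact Submodule.zero_mem _
  have h2 : P T = (p : ℂ) • T := by
    rw [hPeig T 1 (by rw [hT, one_smul])]
    simp
  have h3 : P T ∈ fixedSubmodule (linHom ρ ρ) (repCentralizer ρ y) :=
    hspan (by rw [span_range_rep]; exact Submodule.mem_top)
  have hp' : (p : ℂ) ≠ 0 := by exact_mod_cast hp
  rw [h2] at h3
  have := Submodule.smul_mem _ (p : ℂ)⁻¹ h3
  rwa [smul_smul, inv_mul_cancel₀ hp', one_smul] at this

theorem mem_span_rep_pow {T : Module.End ℂ V}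
    (hT : T ∈ fixedSubmodule (linHom ρ ρ) (repCentralizer ρ y)) {j : ℕ}
    (hg : linHom ρ ρ g T = ω ^ j • T) : T ∈ Submodule.span ℂ {ρ (y ^ j)} := by
  have hT' : T * ρ (y ^ j)⁻¹ * ρ (y ^ j) = T := by rw [mul_assoc, rep_inv_mul_rep, mul_one]
  have hgy : linHom ρ ρ g (ρ (y ^ j)) = ω ^ j • ρ (y ^ j) := by
    rw [map_pow, linHom_self_pow, h.apply_rep, smul_pow]
  obtain ⟨a, ha⟩ := h.eq_smul_one hp (T := T * ρ (y ^ j)⁻¹)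
    (fun c hc => by
      rw [linHom_self_mul, hT c hc, hcomm c hc _ (inv_mem (Subgroup.pow_mem _ self_mem j))])
    ((linHom_mul_rep_iff (pow_ne_zero j (h.isPrimitiveRoot.ne_zero hp)) hgy _).1
      (by rw [hT', hg]))
  rw [ha, smul_mul_assoc, one_mul] at hT'
  exact Submodule.mem_span_singleton.2 ⟨a, hT'⟩

end CentralPair

end CommutativeCase

section CommutativeCaseAtoms

open Representation
open scoped commutatorElement

variable {G : Type} [Group G] {V : Type} [AddCommGroup V] [Module ℂ V]
  [FiniteDimensional ℂ V] {ρ : Representation ℂ G V} [ρ.IsIrreducible]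

namespace CentralPair

variable {p : ℕ} {y g : G} {ω : ℂ} (h : CentralPair ρ p y g ω)

include h

theorem rep_pow_mem_of_mem (hp : p.Prime) {U : Submodule ℂ (Module.End ℂ V)} {i j : ℕ}
    (hj0 : j ≠ 0) (hjp : j < p) (hi : ρ (y ^ i) ∈ U)
    (hj : ∀ T ∈ U, T * ρ (y ^ j) ∈ U) (k : ℕ) : ρ (y ^ k) ∈ U := by
  have hnt := nontrivial_of_isIrreducible (ρ := ρ)
  obtain ⟨e, he⟩ := exists_rep_eq_smul_one h.pow_mem
  have he0 : e ≠ 0 := by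
    rintro rfl
    exact rep_ne_zero (ρ := ρ) _ (he.trans (zero_smul _ _))
  have hmod : ∀ n, ρ (y ^ n) = e ^ (n / p) • ρ (y ^ (n % p)) := fun n => by
    conv_lhs => rw [← Nat.div_add_mod n p, pow_add, pow_mul]
    rw [map_mul, map_pow, he, smul_pow, one_pow, smul_mul_assoc, one_mul]
  have hiter : ∀ m, ρ (y ^ (i + j * m)) ∈ U := fun m => by
    induction m with
    | zero => simpa using hi
    | succ m ih =>
      rw [mul_add, mul_one, ← add_assoc, pow_add, map_mul]
      exact hj _ ih
  have hcop : j.Coprime p := (Nat.coprime_of_lt_prime hj0 hjp hp).symm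
  obtain ⟨j', -, hj'⟩ := Nat.exists_mul_mod_eq_one_of_coprime hcop hp.one_lt
  have hm := hiter (j' * (k + (p - 1) * i))
  have hcong : (i + j * (j' * (k + (p - 1) * i))) % p = k % p := by
    have h1 : j * j' ≡ 1 [MOD p] := by
      rw [Nat.ModEq, hj', Nat.mod_eq_of_lt hp.one_lt]
    have h2 : i + j * (j' * (k + (p - 1) * i)) ≡ i + 1 * (k + (p - 1) * i) [MOD p] := by
      rw [← mul_assoc]
      exact (h1.mul_right _).add_left _
    have h3 : i + 1 * (k + (p - 1) * i) = k + p * i := by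
      obtain ⟨q, rfl⟩ := Nat.exists_eq_succ_of_ne_zero hp.ne_zero
      simp only [Nat.succ_eq_add_one, Nat.add_sub_cancel]
      ring
    rw [h3] at h2
    exact h2.trans (Nat.add_mul_mod_self_left k p i)
  rw [hmod, hcong] at hm
  rw [hmod]
  have h4 := U.smul_mem (e ^ ((i + j * (j' * (k + (p - 1) * i))) / p))⁻¹ hm
  rw [smul_smul, inv_mul_cancel₀ (pow_ne_zero _ he0), one_smul] at h4
  exact U.smul_mem _ h4

theorem isAtom_eigenSub (hp : p.Prime)
    (hcomm : ∀ a ∈ repCentralizer ρ y, ∀ b ∈ repCentralizer ρ y, linHom ρ ρ a (ρ b) = ρ b)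
    (hK : (homKer ρ).Normal) {d : ℕ} {c : G} (hc : c ∈ repCentralizer ρ y)
    (hcg : ∀ a : ℂ, linHom ρ ρ c (ρ (g ^ d)) ≠ a • ρ (g ^ d)) :
    IsAtom (eigenSub (linHom ρ ρ) (homKer ρ) hK y h.commutator_mem (ω⁻¹ ^ d)) := by
  have hnt := nontrivial_of_isIrreducible (ρ := ρ)
  have hω0 := h.isPrimitiveRoot.ne_zero hp.ne_zero
  have hωd : (ω⁻¹ ^ d : ℂ) ≠ 0 := pow_ne_zero _ (inv_ne_zero hω0)
  have hygd : linHom ρ ρ y (ρ (g ^ d)) = ω⁻¹ ^ d • ρ (g ^ d) := by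
    rw [inv_pow]
    exact linHom_self_rep_swap (h.apply_pow d)
  have hdiv : ∀ T : Module.End ℂ V, T * ρ (g ^ d)⁻¹ * ρ (g ^ d) = T := fun T => by
    rw [mul_assoc, rep_inv_mul_rep, mul_one]
  have hgp : ∀ T ∈ fixedSubmodule (linHom ρ ρ) (repCentralizer ρ y),
      linHom ρ ρ (g ^ p) T = T := fun T hT => hT _ h.pow_mem_repCentralizer
  refine ⟨Subrepresentation.ne_bot_of_mem (w := ρ (g ^ d)) ⟨fun x hx => hx _ (Set.mem_univ _),
    hygd⟩ (rep_ne_zero _), fun U hU => ?_⟩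
  by_contra hU0
  refine hU.not_ge ?_
  obtain ⟨u, hu, hu0⟩ := Subrepresentation.exists_mem_ne_zero hU0
  let U' : Submodule ℂ (Module.End ℂ V) :=
    U.toSubmodule.comap (LinearMap.mulRight ℂ (ρ (g ^ d)))
  have hmem : ∀ t, t ∈ U' ↔ t * ρ (g ^ d) ∈ U := fun t => Iff.rfl
  have hU'C : ∀ t ∈ U', t ∈ fixedSubmodule (linHom ρ ρ) (repCentralizer ρ y) := fun t ht =>
    h.mem_fixedSubmodule_of_apply_self hp.ne_zero hcomm
      ((linHom_mul_rep_iff hωd hygd t).1 (hU.le ((hmem t).1 ht)).2)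
  have hU'g : ∀ k, Commute k g → ∀ t ∈ U', linHom ρ ρ k t ∈ U' := by
    intro k hk t ht
    have h1 : linHom ρ ρ k (ρ (g ^ d)) = ρ (g ^ d) := by
      rw [linHom_self_rep, (hk.pow_right d).eq, mul_inv_cancel_right]
    rw [hmem, ← h1, ← linHom_self_mul]
    exact U.apply_mem_toSubmodule k ((hmem t).1 ht)
  let Q : Submodule ℂ (Module.End ℂ V) := fixedSubmodule (linHom ρ ρ) (repCentralizer ρ y) ⊓
    { carrier := {q | ∀ t ∈ U', t * q ∈ U'}
      add_mem' := fun {a b} ha hb t ht => by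
        rw [mul_add]
        exact add_mem (ha t ht) (hb t ht)
      zero_mem' := fun t _ => by
        rw [mul_zero]
        exact zero_mem _
      smul_mem' := fun a q hq t ht => by
        rw [mul_smul_comm]
        exact U'.smul_mem a (hq t ht) }
  have hQg : ∀ q ∈ Q, linHom ρ ρ g q ∈ Q := by
    rintro q ⟨hq, hqU⟩
    refine ⟨apply_mem_fixedSubmodule h.normal g hq, fun t ht => ?_⟩
    have h1 := hU'g g (Commute.refl g) _ (hqU _ (hU'g g⁻¹ (Commute.refl g).inv_left t ht))
    rwa [linHom_self_mul, ← Module.End.mul_apply, ← map_mul, mul_inv_cancel, map_one,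
      Module.End.one_apply] at h1
  have hcomm_eq : linHom ρ ρ c (ρ (g ^ d)) = ρ ⁅c, g ^ d⁆ * ρ (g ^ d) := by
    rw [linHom_self_rep, ← map_mul, commutatorElement_def, inv_mul_cancel_right]
  have hq0 : ρ ⁅c, g ^ d⁆ ∈ Q := by
    refine ⟨fun k hk => hcomm k hk _ (h.mul_comm_mem hp.ne_zero _ _), fun t ht => ?_⟩
    rw [hmem, mul_assoc, ← hcomm_eq, ← hU'C t ht c hc, ← linHom_self_mul]
    exact U.apply_mem_toSubmodule c ((hmem t).1 ht)
  obtain ⟨j, hj0, hjp, hjQ⟩ : ∃ j, j ≠ 0 ∧ j < p ∧ ρ (y ^ j) ∈ Q := by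
    by_contra! hcon
    have h1 : ρ ⁅c, g ^ d⁆ ∈ Submodule.span ℂ {(1 : Module.End ℂ V)} := by
      refine mem_of_eigenvectors_mem hp.ne_zero h.isPrimitiveRoot (hgp _ hq0.1) hQg hq0 ?_
      intro j hj S hS hSg
      obtain ⟨b, rfl⟩ := Submodule.mem_span_singleton.1
        (h.mem_span_rep_pow hp.ne_zero hcomm hS.1 hSg)
      rcases eq_or_ne b 0 with rfl | hb
      · rw [zero_smul]
        exact zero_mem _
      · have hyj := Q.smul_mem b⁻¹ hS
        rw [smul_smul, inv_mul_cancel₀ hb, one_smul] at hyj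
        have hj0 : j = 0 := by
          by_contra hj0
          exact hcon j hj0 hj hyj
        rw [hj0, pow_zero, map_one]
        exact Submodule.smul_mem _ _ (Submodule.mem_span_singleton_self _)
    obtain ⟨a, ha⟩ := Submodule.mem_span_singleton.1 h1
    exact hcg a (by rw [hcomm_eq, ← ha, smul_mul_assoc, one_mul])
  obtain ⟨i, hi⟩ : ∃ i, ρ (y ^ i) ∈ U' := by
    by_contra! hcon
    have huU' : u * ρ (g ^ d)⁻¹ ∈ U' := by rwa [hmem, hdiv]
    have h1 : u * ρ (g ^ d)⁻¹ ∈ (⊥ : Submodule ℂ (Module.End ℂ V)) := by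
      refine mem_of_eigenvectors_mem hp.ne_zero h.isPrimitiveRoot (hgp _ (hU'C _ huU'))
        (hU'g g (Commute.refl g)) huU' ?_
      intro j hj S hS hSg
      obtain ⟨b, rfl⟩ := Submodule.mem_span_singleton.1
        (h.mem_span_rep_pow hp.ne_zero hcomm (hU'C _ hS) hSg)
      rcases eq_or_ne b 0 with rfl | hb
      · rw [zero_smul]
        exact zero_mem _
      · have hyj := U'.smul_mem b⁻¹ hS
        rw [smul_smul, inv_mul_cancel₀ hb, one_smul] at hyj
        exact absurd hyj (hcon j)
    refine hu0 ?_
    rw [← hdiv u, (Submodule.mem_bot ℂ).1 h1, zero_mul]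
  have hall := h.rep_pow_mem_of_mem hp hj0 hjp hi hjQ.2
  intro T hT
  rw [← hdiv T] at hT ⊢
  have hTC := h.mem_fixedSubmodule_of_apply_self hp.ne_zero hcomm
    ((linHom_mul_rep_iff hωd hygd _).1 hT.2)
  refine (hmem _).1 (mem_of_eigenvectors_mem hp.ne_zero h.isPrimitiveRoot (hgp _ hTC)
    (fun S hS => apply_mem_fixedSubmodule h.normal g hS) hTC ?_)
  intro j _ S hS hSg
  obtain ⟨b, rfl⟩ := Submodule.mem_span_singleton.1
    (h.mem_span_rep_pow hp.ne_zero hcomm hS hSg)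
  exact U'.smul_mem b (hall j)

theorem le_eta [Finite G] (hp : p.Prime) :
    2 * (p - 1) + 1 ≤ eta G ρ.character (conjChar ρ.character) := by
  have hnt := nontrivial_of_isIrreducible (ρ := ρ)
  have hinj : Set.InjOn (fun i : ℕ => ω ^ i) (Set.Iio p) := fun i hi j hj hij =>
    h.isPrimitiveRoot.pow_inj hi hj hij
  have hinj' : Set.InjOn (fun i : ℕ => ω⁻¹ ^ i) (Set.Iio p) := fun i hi j hj hij =>
    h.isPrimitiveRoot.inv.pow_inj hi hj hij
  refine card_chain_le_eta (ρ := ρ) (m := 2) hp.ne_zero (K := ![homKer ρ, repCentralizer ρ y])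
    (s := ![y, g]) (t := ![g, y]) (α := ![ω⁻¹, ω]) ?_ ?_ ?_ ?_ ?_ ?_
  · intro k
    fin_cases k
    exacts [homKer_normal ρ, h.normal]
  · intro k
    fin_cases k
    exacts [h.commutator_mem, h.mul_comm_mem hp.ne_zero g]
  · intro k l hkl
    fin_cases k <;> fin_cases l
    all_goals first | exact absurd hkl (by decide) | skip
    exact self_mem
  · intro k
    fin_cases k
    exacts [fun _ hx => hx _ (Set.mem_univ _), fun _ hc => mem_repCentralizer.1 hc]
  · intro k
    fin_cases k
    exacts [linHom_self_rep_swap h.apply_rep, h.apply_rep]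
  · intro k
    fin_cases k
    exacts [hinj', hinj]

theorem eta_le [Finite G] (hp : p.Prime)
    (hcomm : ∀ a ∈ repCentralizer ρ y, ∀ b ∈ repCentralizer ρ y, linHom ρ ρ a (ρ b) = ρ b)
    (hd : ∀ d, d ≠ 0 → d < p →
      ∃ c ∈ repCentralizer ρ y, ∀ a : ℂ, linHom ρ ρ c (ρ (g ^ d)) ≠ a • ρ (g ^ d)) :
    eta G ρ.character (conjChar ρ.character) ≤ 2 * (p - 1) + 1 := by
  have hnt := nontrivial_of_isIrreducible (ρ := ρ)
  have hcard : Fintype.card (Option (Fin 2 × Fin (p - 1))) = 2 * (p - 1) + 1 := by simp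
  have hK : ∀ k, (![homKer ρ, repCentralizer ρ y] k).Normal := by
    intro k
    fin_cases k
    exacts [homKer_normal ρ, h.normal]
  have hs : ∀ k l, ⁅![y, g] k, l⁆ ∈ ![homKer ρ, repCentralizer ρ y] k := by
    intro k
    fin_cases k
    exacts [h.commutator_mem, h.mul_comm_mem hp.ne_zero g]
  have hne : ∀ i, chainFamily ρ p _ hK _ hs ![ω⁻¹, ω] i ≠ ⊥ := by
    refine chainFamily_ne_bot (t := ![g, y]) ?_ ?_
    · intro k
      fin_cases k
      exacts [fun _ hx => hx _ (Set.mem_univ _), fun _ hc => mem_repCentralizer.1 hc]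
    · intro k
      fin_cases k
      exacts [linHom_self_rep_swap h.apply_rep, h.apply_rep]
  rw [← hcard]
  refine eta_le_card ρ (chainFamily ρ p _ hK _ hs ![ω⁻¹, ω]) ?_ ?_
  · rintro (_ | ⟨k, j⟩)
    · refine isAtom_of_forall_mem_span (hne none) (v := (1 : Module.End ℂ V)) fun T hT => ?_
      obtain ⟨a, rfl⟩ := exists_eq_smul_one_of_linHom_fixed (ρ := ρ)
        fun k => hT.1 k (Subgroup.mem_top k)
      exact Submodule.smul_mem _ _ (Submodule.mem_span_singleton_self _)
    · fin_cases k
      · obtain ⟨c, hc, hcg⟩ := hd (j.1 + 1) (Nat.succ_ne_zero _) (by omega)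
        exact h.isAtom_eigenSub hp hcomm (homKer_normal ρ) hc hcg
      · exact isAtom_of_forall_mem_span (hne _) (v := ρ (y ^ (j.1 + 1))) fun T hT =>
          h.mem_span_rep_pow hp.ne_zero hcomm hT.1 hT.2
  · rw [eq_top_iff]
    rintro T -
    have hle : ∀ i, ∀ S ∈ chainFamily ρ p _ hK _ hs ![ω⁻¹, ω] i,
        S ∈ ⨆ i, (chainFamily ρ p _ hK _ hs ![ω⁻¹, ω] i).toSubmodule := fun i S hS =>
      Submodule.mem_iSup_of_mem i hS
    refine mem_of_eigenvectors_mem hp.ne_zero h.isPrimitiveRoot.inv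
      (h.pow_mem T (Set.mem_univ _)) (X := ⊤) (fun _ _ => Submodule.mem_top) Submodule.mem_top ?_
    intro j hj S _ hS
    rcases j with _ | j
    · rw [pow_zero, one_smul] at hS
      have hSC := h.mem_fixedSubmodule_of_apply_self hp.ne_zero hcomm hS
      refine mem_of_eigenvectors_mem hp.ne_zero h.isPrimitiveRoot
        (hSC _ h.pow_mem_repCentralizer)
        (fun R hR => apply_mem_fixedSubmodule h.normal g hR) hSC ?_
      intro i hi R hR hRg
      rcases i with _ | i
      · rw [pow_zero, one_smul] at hRg
        obtain ⟨a, rfl⟩ := h.eq_smul_one hp.ne_zero hR hRg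
        exact hle none _ (mem_chainFamily_none fun k => by rw [map_smul, linHom_self_one])
      · exact hle (some (1, ⟨i, by omega⟩)) R ⟨hR, hRg⟩
    · exact hle (some (0, ⟨j, by omega⟩)) S ⟨fun x hx => hx _ (Set.mem_univ _), hS⟩

end CentralPair

theorem eta_eq_one_of_homKer_eq_top [Finite G] (hK : homKer ρ = ⊤) :
    eta G ρ.character (conjChar ρ.character) = 1 := by
  have hnt := nontrivial_of_isIrreducible (ρ := ρ)
  have hfix : ∀ (T : Module.End ℂ V) k, linHom ρ ρ k T = T := fun T k =>
    (hK ▸ Subgroup.mem_top k : k ∈ homKer ρ) T (Set.mem_univ _)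
  let F : Unit → Subrepresentation (linHom ρ ρ) := fun _ => ⊤
  have hne : ∀ i, F i ≠ ⊥ := fun _ => Subrepresentation.ne_bot_of_mem
    (w := (1 : Module.End ℂ V)) (Submodule.mem_top (R := ℂ)) one_ne_zero
  refine le_antisymm (eta_le_card ρ F (fun i => isAtom_of_forall_mem_span (hne i)
    (v := (1 : Module.End ℂ V)) fun T _ => ?_) ?_)
    (card_le_eta ρ F hne fun i j hij => absurd (Subsingleton.elim i j) hij)
  · obtain ⟨a, rfl⟩ := exists_eq_smul_one_of_linHom_fixed (ρ := ρ) (hfix T)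
    exact Submodule.smul_mem _ _ (Submodule.mem_span_singleton_self _)
  · exact iSup_const

end CommutativeCaseAtoms

/-- Let `p` be an odd prime, `G` a finite `p`-group, `χ ∈ Irr(G)`. If `η(χ,χ̄) < 4p - 3`
then `η(χ,χ̄) = 1` or `η(χ,χ̄) = 2p - 1`. -/
theorem eta_gap_odd_prime {p : ℕ} (hp : p.Prime) (hodd : Odd p)
    (G : Type) [Group G] [Finite G] (hG : IsPGroup p G)
    (χ : G → ℂ) (hχ : IsIrrChar G χ)
    (hlt : eta G χ (conjChar χ) < 4 * p - 3) :
    eta G χ (conjChar χ) = 1 ∨ eta G χ (conjChar χ) = 2 * p - 1 := by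
  obtain ⟨V, _, _, _, ρ, hρ, rfl⟩ := hχ.exists_isIrreducible
  have hp2 := hp.two_le
  by_cases hK : homKer ρ = ⊤
  · exact Or.inl (eta_eq_one_of_homKer_eq_top hK)
  obtain ⟨y, g, ω, h⟩ := exists_centralPair hp hG hK
  have hcomm : ∀ a ∈ repCentralizer ρ y, ∀ b ∈ repCentralizer ρ y,
      Representation.linHom ρ ρ a (ρ b) = ρ b := by
    by_contra! hC
    have := h.le_eta_of_not_commute hp hG hC
    omega
  have hd : ∀ d, d ≠ 0 → d < p → ∃ c ∈ repCentralizer ρ y, ∀ a : ℂ,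
      Representation.linHom ρ ρ c (ρ (g ^ d)) ≠ a • ρ (g ^ d) := by
    intro d hd0 hdp
    by_contra! hC
    have h1 := h.mul_self_le_eta hp.ne_zero (Nat.coprime_of_lt_prime hd0 hdp hp).symm hC
    have h3 : 3 ≤ p := by
      obtain ⟨k, rfl⟩ := hodd
      omega
    have h4 : 4 * p ≤ p * p + 3 := by nlinarith
    omega
  have h1 := h.le_eta hp
  have h2 := h.eta_le hp hcomm hd
  right
  omega
end

section
/- Let p be a prime number, G a finite p-group, and χ, ψ irreducible complex characters of G with χ(1) = p^n. Assume there exists a linear character α of G such that the inner product [α, χψ] is nonzero. Then η(χ, ψ) ≥ 2n(p−1) + 1. -/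
open scoped Classical

open Module Representation

/-- The trace of the inverse of an operator of finite order is the conjugate of its trace. -/
theorem LinearMap.trace_eq_conj_trace_of_pow_eq_one {V : Type*} [AddCommGroup V] [Module ℂ V]
    [FiniteDimensional ℂ V] {f f' : Module.End ℂ V} {k : ℕ} (hk : k ≠ 0) (hf : f ^ k = 1)
    (hff' : f' * f = 1) :
    (starRingEnd ℂ) (LinearMap.trace ℂ V f) = LinearMap.trace ℂ V f' := by
  have hss : f.IsSemisimple := by
    refine Module.End.isSemisimple_of_squarefree_aeval_eq_zero
      (p := (Polynomial.X ^ k - 1 : Polynomial ℂ)) ?_ (by simp [hf])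
    have := Polynomial.separable_X_pow_sub_C (F := ℂ) 1 (by exact_mod_cast hk) one_ne_zero
    simpa using this.squarefree
  have hinternal : DirectSum.IsInternal f.eigenspace := by
    refine (DirectSum.isInternal_submodule_iff_iSupIndep_and_iSup_eq_top _).2
      ⟨f.eigenspaces_iSupIndep, hss.iSup_eigenspace_eq_top⟩
  have hfin : {μ | f.eigenspace μ ≠ ⊥}.Finite :=
    WellFoundedGT.finite_ne_bot_of_iSupIndep f.eigenspaces_iSupIndep
  have hμ (μ : ℂ) (v : V) (hv : v ∈ f.eigenspace μ) : f' v = (starRingEnd ℂ) μ • v := by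
    rcases eq_or_ne v 0 with rfl | hv0
    · simp
    rw [Module.End.mem_eigenspace_iff] at hv
    have hpow : ∀ j : ℕ, (f ^ j) v = μ ^ j • v := by
      intro j
      induction j with
      | zero => simp
      | succ j ih => rw [pow_succ', Module.End.mul_apply, ih, map_smul, hv, smul_smul, pow_succ]
    have h1 : μ ^ k = 1 := by
      have h := hpow k
      rw [hf, Module.End.one_apply] at h
      have h2 : (μ ^ k - 1) • v = 0 := by rw [sub_smul, ← h, one_smul, sub_self]
      exact sub_eq_zero.1 ((smul_eq_zero.1 h2).resolve_right hv0)
    have hn : ‖μ‖ = 1 := Complex.norm_eq_one_of_pow_eq_one h1 hk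
    have h3 : (starRingEnd ℂ) μ * μ = 1 := by
      rw [mul_comm, Complex.mul_conj, Complex.normSq_eq_norm_sq, hn]; simp
    have h4 : f' (f v) = v := by rw [← Module.End.mul_apply, hff', Module.End.one_apply]
    calc f' v = (starRingEnd ℂ) μ • f' (f v) := by
          rw [hv, map_smul, smul_smul, h3, one_smul]
      _ = _ := by rw [h4]
  have hm : ∀ μ, Set.MapsTo f (f.eigenspace μ) (f.eigenspace μ) := fun μ v hv => by
    have := Module.End.mem_eigenspace_iff.1 hv
    rw [this]
    exact Submodule.smul_mem _ _ hv
  have hm' : ∀ μ, Set.MapsTo f' (f.eigenspace μ) (f.eigenspace μ) := fun μ v hv => by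
    rw [hμ μ v hv]
    exact Submodule.smul_mem _ _ hv
  rw [LinearMap.trace_eq_sum_trace_restrict' hinternal hfin hm,
    LinearMap.trace_eq_sum_trace_restrict' hinternal hfin hm', map_sum]
  refine Finset.sum_congr rfl fun μ _ => ?_
  have e1 : f.restrict (hm μ) = μ • LinearMap.id := by
    ext v
    exact Module.End.mem_eigenspace_iff.1 v.2
  have e2 : f'.restrict (hm' μ) = (starRingEnd ℂ) μ • LinearMap.id := by
    ext v
    exact hμ μ v v.2
  rw [e1, e2]
  simp

section Characters

variable {G : Type} [Group G] [Finite G]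

namespace Representation

variable {V W : Type*} [AddCommGroup V] [Module ℂ V] [FiniteDimensional ℂ V]
  [AddCommGroup W] [Module ℂ W] [FiniteDimensional ℂ W]

theorem conj_character (ρ : Representation ℂ G V) (g : G) :
    (starRingEnd ℂ) (ρ.character g) = ρ.character g⁻¹ := by
  refine LinearMap.trace_eq_conj_trace_of_pow_eq_one (k := Nat.card G) Nat.card_pos.ne' ?_ ?_
  · rw [← map_pow, pow_card_eq_one', map_one]
  · rw [← map_mul, inv_mul_cancel, map_one]

theorem charInner_character (ρ : Representation ℂ G V) (σ : Representation ℂ G W) :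
    charInner G σ.character ρ.character = finrank ℂ (IntertwiningMap ρ σ) := by
  have := Fintype.ofFinite G
  have : Invertible (Nat.card G : ℂ) :=
    invertibleOfNonzero (Nat.cast_ne_zero.2 Nat.card_pos.ne')
  rw [← card_inv_mul_sum_char_mul_char_eq_finrank, charInner, finsum_eq_sum_of_fintype]
  simp_rw [conj_character]

theorem finrank_invariants (ρ : Representation ℂ G V) :
    (finrank ℂ ρ.invariants : ℂ) = (Nat.card G : ℂ)⁻¹ * ∑ᶠ g : G, ρ.character g := by
  have := Fintype.ofFinite G
  have : Invertible (Nat.card G : ℂ) :=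
    invertibleOfNonzero (Nat.cast_ne_zero.2 Nat.card_pos.ne')
  rw [← card_inv_mul_sum_char_eq_finrank, finsum_eq_sum_of_fintype]

end Representation

theorem isIrrChar_of_charInner_self {V : Type} [AddCommGroup V] [Module ℂ V]
    [FiniteDimensional ℂ V] (ρ : Representation ℂ G V)
    (h : charInner G ρ.character ρ.character = 1) : IsIrrChar G ρ.character := by
  have := Fintype.ofFinite G
  refine ⟨FDRep.of ρ, (FDRep.simple_iff_char_is_norm_one _).2 ?_, rfl⟩
  rw [charInner, finsum_eq_sum_of_fintype] at h
  simp_rw [conj_character] at h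
  rwa [inv_mul_eq_one₀ (Nat.cast_ne_zero.2 Nat.card_pos.ne'), eq_comm] at h

theorem isIrrChar_of_isIrreducible {V : Type} [AddCommGroup V] [Module ℂ V]
    [FiniteDimensional ℂ V] (ρ : Representation ℂ G V) [IsIrreducible ρ] :
    IsIrrChar G ρ.character :=
  isIrrChar_of_charInner_self ρ (by rw [charInner_character]; simp)

open CategoryTheory in
omit [Finite G] in
theorem FDRep.isIrreducible_of_simple (V : FDRep ℂ G) [Simple V] :
    IsIrreducible (V.ρ : Representation ℂ G V) := by
  have key (W : Subrepresentation (V.ρ : Representation ℂ G V)) : W = ⊥ ∨ W = ⊤ := by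
    let f : FDRep.of W.toRepresentation ⟶ V :=
      ⟨InducedCategory.homMk (ModuleCat.ofHom W.toSubmodule.subtype), fun g => by
        ext x; rfl⟩
    have hfx (x : W.toSubmodule) : f.hom.hom x = (x : V) := rfl
    have : Mono f := by
      refine (forget (FDRep ℂ G)).mono_of_mono_map ?_
      refine (mono_iff_injective _).2 fun x y hxy => Subtype.ext hxy
    by_cases hf : f = 0
    · left
      refine Subrepresentation.toSubmodule_injective ?_
      refine (Submodule.eq_bot_iff _).2 fun x hx => ?_
      refine (hfx ⟨x, hx⟩).symm.trans ?_
      rw [hf]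
      rfl
    · right
      have : IsIso f := (Simple.mono_isIso_iff_nonzero f).2 hf
      refine Subrepresentation.toSubmodule_injective ?_
      refine (Submodule.eq_top_iff').2 fun x => ?_
      let e := FDRep.isoToLinearEquiv (asIso f)
      have : e (e.symm x) = x := e.apply_symm_apply x
      rw [← this]
      exact (e.symm x).2
  have : Nontrivial V := by
    by_contra h
    rw [not_nontrivial_iff_subsingleton] at h
    apply Simple.not_isZero V
    rw [Limits.IsZero.iff_id_eq_zero]
    ext x
    exact Subsingleton.elim (α := V) _ _
  have : Nontrivial (Subrepresentation (V.ρ : Representation ℂ G V)) := by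
    refine ⟨⊥, ⊤, fun h => ?_⟩
    exact bot_ne_top (α := Submodule ℂ V) (congrArg Subrepresentation.toSubmodule h)
  exact ⟨key⟩

omit [Finite G] in
theorem IsIrrChar.exists_representation {χ : G → ℂ} (h : IsIrrChar G χ) :
    ∃ (V : Type) (_ : AddCommGroup V) (_ : Module ℂ V) (_ : FiniteDimensional ℂ V)
      (ρ : Representation ℂ G V), IsIrreducible ρ ∧ ρ.character = χ := by
  obtain ⟨V, hV, rfl⟩ := h
  exact ⟨V, inferInstance, inferInstance, inferInstance, V.ρ, FDRep.isIrreducible_of_simple V, rfl⟩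

theorem conj_charInner (φ ψ : G → ℂ) :
    (starRingEnd ℂ) (charInner G φ ψ) = charInner G ψ φ := by
  have := Fintype.ofFinite G
  simp only [charInner, finsum_eq_sum_of_fintype, map_mul, map_inv₀, map_natCast, map_sum,
    Complex.conj_conj, mul_comm]

theorem charInner_sum_smul {ι : Type*} (s : Finset ι) (c : ι → ℂ) (φ : ι → G → ℂ) (ψ : G → ℂ) :
    charInner G (∑ i ∈ s, c i • φ i) ψ = ∑ i ∈ s, c i * charInner G (φ i) ψ := by
  have := Fintype.ofFinite G
  simp only [charInner, finsum_eq_sum_of_fintype, Finset.sum_apply, Pi.smul_apply, smul_eq_mul,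
    Finset.sum_mul, Finset.mul_sum]
  rw [Finset.sum_comm]
  exact Finset.sum_congr rfl fun i _ => Finset.sum_congr rfl fun g _ => by ring

theorem IsIrrChar.charInner_self {χ : G → ℂ} (h : IsIrrChar G χ) : charInner G χ χ = 1 := by
  obtain ⟨V, _, _, _, ρ, hρ, rfl⟩ := h.exists_representation
  rw [charInner_character]
  simp

theorem IsIrrChar.eq_of_charInner_ne_zero {χ ψ : G → ℂ} (hχ : IsIrrChar G χ)
    (hψ : IsIrrChar G ψ) (h : charInner G χ ψ ≠ 0) : χ = ψ := by
  obtain ⟨V, _, _, _, ρ, hρ, rfl⟩ := hχ.exists_representation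
  obtain ⟨W, _, _, _, σ, hσ, rfl⟩ := hψ.exists_representation
  rw [charInner_character] at h
  by_contra hne
  have : IsEmpty (Equiv σ ρ) := ⟨fun e => hne (char_iso e).symm⟩
  exact h (by simp [finrank_eq_zero_of_subsingleton])

theorem finite_setOf_isIrrChar : {χ : G → ℂ | IsIrrChar G χ}.Finite := by
  have := Fintype.ofFinite G
  have hli : LinearIndependent ℂ (Subtype.val : {χ : G → ℂ | IsIrrChar G χ} → G → ℂ) := by
    rw [linearIndependent_iff']
    intro s c hc i hi
    have h := charInner_sum_smul s c (fun χ => χ.1) i.1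
    rw [hc, Finset.sum_eq_single_of_mem i hi, i.2.charInner_self, mul_one] at h
    · rw [← h]
      simp [charInner]
    · intro j _ hji
      by_contra h0
      exact hji (Subtype.ext (j.2.eq_of_charInner_ne_zero i.2 (right_ne_zero_of_mul h0)))
  exact hli.setFinite

omit [Finite G] in
theorem Representation.nontrivial_of_isIrreducible {V : Type*} [AddCommGroup V] [Module ℂ V]
    (ρ : Representation ℂ G V) [IsIrreducible ρ] : Nontrivial V := by
  by_contra h
  rw [not_nontrivial_iff_subsingleton] at h
  exact bot_ne_top (α := Subrepresentation ρ)
    (Subrepresentation.toSubmodule_injective (Subsingleton.elim _ _))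

namespace Subrepresentation

variable {E : Type} [AddCommGroup E] [Module ℂ E] {π : Representation ℂ G E}

omit [Finite G] in
theorem isIrreducible_of_isAtom_s3 {B : Subrepresentation π} (hB : IsAtom B) :
    IsIrreducible B.toRepresentation := by
  have hB0 : B.toSubmodule ≠ ⊥ := fun h => hB.1 (toSubmodule_injective h)
  have : Nontrivial B.toSubmodule := Submodule.nontrivial_iff_ne_bot.2 hB0
  have : Nontrivial (Subrepresentation B.toRepresentation) :=
    ⟨⊥, ⊤, fun h => bot_ne_top (α := Submodule ℂ B.toSubmodule) (congrArg toSubmodule h)⟩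
  refine ⟨fun C => ?_⟩
  let C' : Subrepresentation π :=
    ⟨C.toSubmodule.map B.toSubmodule.subtype, by
      rintro g _ ⟨v, hv, rfl⟩
      exact ⟨_, C.apply_mem_toSubmodule g hv, rfl⟩⟩
  have hC' : C' ≤ B := by
    rintro _ ⟨v, _, rfl⟩
    exact v.2
  rcases hB.le_iff.1 hC' with h | h
  · left
    refine toSubmodule_injective ?_
    have : C.toSubmodule.map B.toSubmodule.subtype = ⊥ := congrArg toSubmodule h
    exact Submodule.map_injective_of_injective B.toSubmodule.injective_subtype
      (this.trans (Submodule.map_bot _).symm)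
  · right
    refine toSubmodule_injective ?_
    have : C.toSubmodule.map B.toSubmodule.subtype = B.toSubmodule := congrArg toSubmodule h
    refine (Submodule.eq_top_iff').2 fun x => ?_
    obtain ⟨y, hy, hyx⟩ := this.ge x.2
    rwa [← Subtype.ext hyx]

omit [Finite G] in
theorem exists_isIrreducible_le [FiniteDimensional ℂ E] {A : Subrepresentation π} (hA : A ≠ ⊥) :
    ∃ B ≤ A, IsIrreducible B.toRepresentation := by
  have : WellFoundedLT (Subrepresentation π) :=
    StrictMono.wellFoundedLT (f := (toSubmodule : Subrepresentation π → Submodule ℂ E))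
      fun _ _ h => h
  have := isAtomic_of_orderBot_wellFounded_lt (α := Subrepresentation π) wellFounded_lt
  obtain ⟨B, hB, hBA⟩ := (eq_bot_or_exists_atom_le A).resolve_left hA
  exact ⟨B, hBA, isIrreducible_of_isAtom_s3 hB⟩

theorem charInner_toRepresentation_ne_zero [FiniteDimensional ℂ E] (B : Subrepresentation π)
    [IsIrreducible B.toRepresentation] :
    charInner G B.toRepresentation.character π.character ≠ 0 := by
  rw [← conj_charInner, map_ne_zero, charInner_character, Nat.cast_ne_zero]
  let f : IntertwiningMap B.toRepresentation π := ⟨B.toSubmodule.subtype, fun g => by ext; rfl⟩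
  have hf : f ≠ 0 := fun h => by
    have := B.toRepresentation.nontrivial_of_isIrreducible
    obtain ⟨x, hx⟩ := exists_ne (0 : B.toSubmodule)
    exact hx (Subtype.ext (congrArg (fun f : IntertwiningMap B.toRepresentation π => f x) h))
  exact (finrank_pos_iff_exists_ne_zero.2 ⟨f, hf⟩).ne'

variable (π) in
/-- The vectors fixed by a normal subgroup `N` on which an element `z`, central modulo `N`, acts
as the scalar `ω`. -/
def eigen (N : Subgroup G) [N.Normal] (z : G) (hz : ∀ g, z⁻¹ * g⁻¹ * z * g ∈ N) (ω : ℂ) :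
    Subrepresentation π where
  toSubmodule :=
    { carrier := {v | (∀ n ∈ N, π n v = v) ∧ π z v = ω • v}
      zero_mem' := by simp
      add_mem' := by
        rintro a b ⟨ha, ha'⟩ ⟨hb, hb'⟩
        exact ⟨fun n hn => by rw [map_add, ha n hn, hb n hn], by rw [map_add, ha', hb', smul_add]⟩
      smul_mem' := by
        rintro c a ⟨ha, ha'⟩
        exact ⟨fun n hn => by rw [map_smul, ha n hn], by rw [map_smul, ha', smul_comm]⟩ }
  apply_mem_toSubmodule := by
    rintro g v ⟨hv, hv'⟩
    refine ⟨fun n hn => ?_, ?_⟩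
    · have h := hv (g⁻¹ * n * g) (by simpa using Subgroup.Normal.conj_mem ‹_› n hn g⁻¹)
      calc π n (π g v) = π g (π (g⁻¹ * n * g) v) := by
            simp only [← Module.End.mul_apply, ← map_mul]; congr 2; group
        _ = _ := by rw [h]
    · calc π z (π g v) = π g (π z (π (z⁻¹ * g⁻¹ * z * g) v)) := by
            simp only [← Module.End.mul_apply, ← map_mul]; congr 2; group
        _ = _ := by rw [hv _ (hz g), hv', map_smul]

omit [Finite G] in
theorem mem_eigen {N : Subgroup G} [N.Normal] {z : G} {hz : ∀ g, z⁻¹ * g⁻¹ * z * g ∈ N} {ω : ℂ}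
    {v : E} : v ∈ (eigen π N z hz ω).toSubmodule ↔ (∀ n ∈ N, π n v = v) ∧ π z v = ω • v := Iff.rfl

theorem exists_constituent_of_eigen_ne_bot [FiniteDimensional ℂ E] {N : Subgroup G} [N.Normal]
    {z : G} {hz : ∀ g, z⁻¹ * g⁻¹ * z * g ∈ N} {ω : ℂ} (h : eigen π N z hz ω ≠ ⊥) :
    ∃ θ ∈ constituents G π.character, θ 1 ≠ 0 ∧ (∀ n ∈ N, θ n = θ 1) ∧ θ z = ω * θ 1 := by
  obtain ⟨B, hB, hirr⟩ := exists_isIrreducible_le h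
  have hB' (v : B.toSubmodule) := mem_eigen.1 (hB v.2)
  refine ⟨_, ⟨isIrrChar_of_isIrreducible B.toRepresentation,
    B.charInner_toRepresentation_ne_zero⟩, ?_, fun n hn => ?_, ?_⟩
  · rw [char_one, Nat.cast_ne_zero]
    have := B.toRepresentation.nontrivial_of_isIrreducible
    exact finrank_pos.ne'
  · have : B.toRepresentation n = B.toRepresentation 1 := by
      rw [map_one]
      exact LinearMap.ext fun v => Subtype.ext ((hB' v).1 n hn)
    rw [Representation.character, this, Representation.character]
  · have : B.toRepresentation z = ω • B.toRepresentation 1 := by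
      rw [map_one]
      exact LinearMap.ext fun v => Subtype.ext (hB' v).2
    rw [Representation.character, this, map_smul, smul_eq_mul, Representation.character]

end Subrepresentation

theorem Module.End.exists_eigenvector_of_pow_apply_eq {E : Type*} [AddCommGroup E] [Module ℂ E]
    {p : ℕ} (hp : p.Prime) {φ : Module.End ℂ E} {v : E} (hv : (φ ^ p) v = v) (hv1 : φ v ≠ v) :
    ∃ ω : ℂ, ω ^ p = 1 ∧ ω ≠ 1 ∧ ∃ u ∈ Submodule.span ℂ (Set.range fun i : ℕ => (φ ^ i) v),
      u ≠ 0 ∧ φ u = ω • u := by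
  obtain ⟨ζ, hζ⟩ : ∃ ζ : ℂ, IsPrimitiveRoot ζ p :=
    ⟨_, Complex.isPrimitiveRoot_exp p hp.ne_zero⟩
  have hζ0 : ζ ≠ 0 := hζ.ne_zero hp.ne_zero
  let u : ℕ → E := fun j => ∑ i ∈ Finset.range p, (ζ ^ j) ^ i • (φ ^ i) v
  have hu (j : ℕ) : ζ ^ j • φ (u j) = u j := by
    have h1 : ζ ^ j • φ (u j) = ∑ i ∈ Finset.range p, (ζ ^ j) ^ (i + 1) • (φ ^ (i + 1)) v := by
      simp only [u, map_sum, map_smul, Finset.smul_sum, smul_smul]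
      refine Finset.sum_congr rfl fun i _ => ?_
      rw [pow_succ' φ, Module.End.mul_apply, pow_succ' (ζ ^ j)]
    have h2 := Finset.sum_range_succ (fun i => (ζ ^ j) ^ i • (φ ^ i) v) p
    rw [Finset.sum_range_succ'] at h2
    have h3 : (ζ ^ j) ^ p = 1 := by rw [pow_right_comm, hζ.pow_eq_one, one_pow]
    rw [h1]
    simpa [h3, hv] using h2
  have hmem (j : ℕ) : u j ∈ Submodule.span ℂ (Set.range fun i : ℕ => (φ ^ i) v) :=
    Submodule.sum_mem _ fun i _ => Submodule.smul_mem _ _ (Submodule.subset_span ⟨i, rfl⟩)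
  have hsum : ∑ j ∈ Finset.range p, u j = (p : ℂ) • v := by
    simp only [u]
    rw [Finset.sum_comm, Finset.sum_eq_single_of_mem 0 (Finset.mem_range.2 hp.pos)]
    · simp [Nat.cast_smul_eq_nsmul]
    · intro i hi hi0
      have hi' : i.Coprime p := ((Nat.Prime.coprime_iff_not_dvd hp).2
        (Nat.not_dvd_of_pos_of_lt (Nat.pos_of_ne_zero hi0) (Finset.mem_range.1 hi))).symm
      rw [← Finset.sum_smul]
      simp_rw [pow_right_comm ζ _ i]
      rw [(hζ.pow_of_coprime i hi').geom_sum_eq_zero hp.one_lt, zero_smul]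
  obtain ⟨j, hj, hj0, huj⟩ : ∃ j ∈ Finset.range p, j ≠ 0 ∧ u j ≠ 0 := by
    by_contra! h
    rw [Finset.sum_eq_single_of_mem 0 (Finset.mem_range.2 hp.pos) h] at hsum
    have h0 := hu 0
    rw [hsum, pow_zero, one_smul, map_smul] at h0
    exact hv1 (smul_right_injective E (Nat.cast_ne_zero.2 hp.ne_zero : (p : ℂ) ≠ 0) h0)
  refine ⟨(ζ ^ j)⁻¹, ?_, ?_, u j, hmem j, huj, ?_⟩
  · rw [inv_pow, pow_right_comm, hζ.pow_eq_one, one_pow, inv_one]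
  · rw [inv_ne_one]
    exact hζ.pow_ne_one_of_pos_of_lt hj0 (Finset.mem_range.1 hj)
  · nth_rewrite 2 [← hu j]
    rw [inv_smul_smul₀ (pow_ne_zero _ hζ0)]

namespace Subrepresentation

variable {V : Type} [AddCommGroup V] [Module ℂ V] {ρ : Representation ℂ G V}

omit [Finite G] in
theorem exists_mem_ne_zero_s3 {E : Type*} [AddCommGroup E] [Module ℂ E] {π : Representation ℂ G E}
    {A : Subrepresentation π} (hA : A ≠ ⊥) : ∃ v ∈ A.toSubmodule, v ≠ 0 :=
  Submodule.exists_mem_ne_zero_of_ne_bot fun h => hA (toSubmodule_injective h)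

omit [Finite G] in
theorem ne_bot_of_mem_s3 {E : Type*} [AddCommGroup E] [Module ℂ E] {π : Representation ℂ G E}
    {A : Subrepresentation π} {v : E} (hv : v ∈ A.toSubmodule) (hv0 : v ≠ 0) : A ≠ ⊥ := by
  rintro rfl
  exact hv0 hv

omit [Finite G] in
theorem exists_comp_ne_zero [IsIrreducible ρ] {A B : Subrepresentation (linHom ρ ρ)} (hA : A ≠ ⊥)
    (hB : B ≠ ⊥) : ∃ S ∈ A.toSubmodule, ∃ T ∈ B.toSubmodule, S ∘ₗ T ≠ 0 := by
  by_contra! h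
  obtain ⟨S, hS, hS0⟩ := exists_mem_ne_zero_s3 hA
  obtain ⟨T, hT, hT0⟩ := exists_mem_ne_zero_s3 hB
  let W : Subrepresentation ρ :=
    { toSubmodule := ⨆ T : B.toSubmodule, LinearMap.range (T : V →ₗ[ℂ] V)
      apply_mem_toSubmodule := by
        intro g v hv
        rw [← Submodule.mem_comap]
        refine (iSup_le fun T : B.toSubmodule => ?_ :
          ⨆ T : B.toSubmodule, LinearMap.range (T : V →ₗ[ℂ] V) ≤ _) hv
        rintro _ ⟨v, rfl⟩
        refine Submodule.mem_iSup_of_mem ⟨_, B.apply_mem_toSubmodule g T.2⟩ ⟨ρ g v, ?_⟩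
        simp [linHom_apply] }
  have hW : W = ⊤ := by
    refine (eq_bot_or_eq_top W).resolve_left fun hW => hT0 ?_
    have h1 : LinearMap.range T ≤ W.toSubmodule :=
      le_iSup (fun T : B.toSubmodule => LinearMap.range (T : V →ₗ[ℂ] V)) ⟨T, hT⟩
    rw [hW] at h1
    exact LinearMap.range_eq_bot.1 (le_bot_iff.1 h1)
  have hker : W.toSubmodule ≤ LinearMap.ker S := iSup_le fun T => by
    rw [LinearMap.range_le_ker_iff]
    exact h S hS T T.2
  rw [hW] at hker
  exact hS0 (LinearMap.ker_eq_top.1 (top_le_iff.1 hker))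

omit [Finite G] in
theorem eigen_mul_ne_bot [IsIrreducible ρ] {N : Subgroup G} [N.Normal] {z : G}
    {hz : ∀ g, z⁻¹ * g⁻¹ * z * g ∈ N} {ω ω' : ℂ} (h : eigen (linHom ρ ρ) N z hz ω ≠ ⊥)
    (h' : eigen (linHom ρ ρ) N z hz ω' ≠ ⊥) : eigen (linHom ρ ρ) N z hz (ω * ω') ≠ ⊥ := by
  obtain ⟨S, hS, T, hT, hST⟩ := exists_comp_ne_zero h h'
  have hmul (g : G) : linHom ρ ρ g (S ∘ₗ T) = linHom ρ ρ g S ∘ₗ linHom ρ ρ g T := by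
    ext v
    simp [linHom_apply]
  refine ne_bot_of_mem_s3 (v := S ∘ₗ T) (mem_eigen.2 ⟨fun n hn => ?_, ?_⟩) hST
  · rw [hmul, hS.1 n hn, hT.1 n hn]
  · rw [hmul, hS.2, hT.2, LinearMap.comp_smul, LinearMap.smul_comp, smul_smul, mul_comm]

omit [Finite G] in
theorem eigen_pow_ne_bot [IsIrreducible ρ] {N : Subgroup G} [N.Normal] {z : G}
    {hz : ∀ g, z⁻¹ * g⁻¹ * z * g ∈ N} {ω : ℂ} (h : eigen (linHom ρ ρ) N z hz ω ≠ ⊥) (i : ℕ) :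
    eigen (linHom ρ ρ) N z hz (ω ^ (i + 1)) ≠ ⊥ := by
  induction i with
  | zero => simpa using h
  | succ i ih => exact eigen_mul_ne_bot ih h

omit [Finite G] in
theorem exists_eigen_ne_bot {E : Type} [AddCommGroup E] [Module ℂ E] {π : Representation ℂ G E}
    {p : ℕ} (hp : p.Prime) {N : Subgroup G} [N.Normal] {z : G}
    (hz : ∀ g, z⁻¹ * g⁻¹ * z * g ∈ N) (hzp : z ^ p ∈ N) {v : E} (hv : ∀ n ∈ N, π n v = v)
    (hv1 : π z v ≠ v) : ∃ ω : ℂ, ω ^ p = 1 ∧ ω ≠ 1 ∧ eigen π N z hz ω ≠ ⊥ := by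
  obtain ⟨ω, hωp, hω1, u, hu, hu0, hzu⟩ := Module.End.exists_eigenvector_of_pow_apply_eq hp
    (φ := π z) (v := v) (by rw [← map_pow, hv _ hzp]) hv1
  refine ⟨ω, hωp, hω1, ne_bot_of_mem_s3 (v := u) (mem_eigen.2 ⟨fun n hn => ?_, hzu⟩) hu0⟩
  clear hzu hu0
  induction hu using Submodule.span_induction with
  | mem x hx =>
    obtain ⟨i, rfl⟩ := hx
    have h := hv ((z ^ i)⁻¹ * n * z ^ i)
      (by simpa using Subgroup.Normal.conj_mem ‹_› n hn (z ^ i)⁻¹)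
    simp only [← map_pow]
    calc π n (π (z ^ i) v) = π (z ^ i) (π ((z ^ i)⁻¹ * n * z ^ i) v) := by
          simp only [← Module.End.mul_apply, ← map_mul]; congr 2; group
      _ = _ := by rw [h]
  | zero => simp
  | add x y _ _ hx hy => rw [map_add, hx, hy]
  | smul c x _ hx => rw [map_smul, hx]

end Subrepresentation

theorem IsPGroup.exists_central_step {p : ℕ} (hp : p.Prime) (hG : IsPGroup p G) {N : Subgroup G}
    [hN : N.Normal] (hNtop : N ≠ ⊤) :
    ∃ z ∉ N, z ^ p ∈ N ∧ (∀ g, z⁻¹ * g⁻¹ * z * g ∈ N) ∧ ∃ M : Subgroup G, M.Normal ∧ N < M ∧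
      z ∈ M ∧ (∀ x ∈ M, ∃ i : ℕ, ∃ n ∈ N, x = z ^ i * n) ∧ Nat.card M = p * Nat.card N := by
  have := Fact.mk hp
  have hQ : IsPGroup p (G ⧸ N) := hG.to_quotient N
  have : Nontrivial (G ⧸ N) := QuotientGroup.nontrivial_iff.2 hNtop
  have : Nontrivial (Subgroup.center (G ⧸ N)) := hQ.center_nontrivial
  obtain ⟨m, hm0, hm⟩ := (hQ.to_subgroup (Subgroup.center (G ⧸ N))).nontrivial_iff_card.1 this
  obtain ⟨c, hc⟩ := exists_prime_orderOf_dvd_card' (G := Subgroup.center (G ⧸ N)) p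
    (by rw [hm]; exact dvd_pow_self p hm0.ne')
  obtain ⟨z, hz⟩ := QuotientGroup.mk'_surjective N c.1
  have hco : orderOf (c : G ⧸ N) = p := by rw [Subgroup.orderOf_coe, hc]
  have hcc (x : G ⧸ N) : c.1 * x = x * c.1 := (Subgroup.mem_center_iff.1 c.2 x).symm
  have hker (g : G) : g ∈ N ↔ QuotientGroup.mk' N g = 1 := by
    rw [QuotientGroup.mk'_apply, QuotientGroup.eq_one_iff]
  let Z := Subgroup.zpowers (c : G ⧸ N)
  have hZ : Z.Normal := ⟨fun x hx g => by
    obtain ⟨i, rfl⟩ := Subgroup.mem_zpowers_iff.1 hx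
    have : Commute (c : G ⧸ N) g := hcc g
    rw [← (this.zpow_left i).eq, mul_inv_cancel_right]
    exact hx⟩
  have hzM : z ∈ Z.comap (QuotientGroup.mk' N) := by
    rw [Subgroup.mem_comap, hz]
    exact Subgroup.mem_zpowers _
  have hzN : z ∉ N := by
    rw [hker, hz]
    intro h
    rw [h, orderOf_one] at hco
    exact hp.one_lt.ne hco
  have hNM : N ≤ Z.comap (QuotientGroup.mk' N) := fun n hn => by
    rw [Subgroup.mem_comap, (hker n).1 hn]
    exact one_mem _
  refine ⟨z, hzN, ?_, fun g => ?_, Z.comap (QuotientGroup.mk' N), hZ.comap _,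
    lt_of_le_of_ne hNM fun h => hzN (h ▸ hzM), hzM, fun x hx => ?_, ?_⟩
  · rw [hker, map_pow, hz, ← hco, pow_orderOf_eq_one]
  · rw [hker]
    simp only [map_mul, map_inv, hz]
    rw [mul_assoc, hcc]
    group
  · obtain ⟨i, hi⟩ := mem_powers_iff_mem_zpowers.2 (Subgroup.mem_comap.1 hx)
    dsimp only at hi
    refine ⟨i, (z ^ i)⁻¹ * x, ?_, by group⟩
    rw [hker, map_mul, map_inv, map_pow, hz, hi, inv_mul_cancel]
  · have h1 := Subgroup.relIndex_mul_relIndex ⊥ N (Z.comap (QuotientGroup.mk' N)) bot_le hNM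
    rw [Subgroup.relIndex_bot_left, Subgroup.relIndex_bot_left] at h1
    have h2 := Subgroup.relIndex_ker (Z.comap (QuotientGroup.mk' N)) (QuotientGroup.mk' N)
    rw [QuotientGroup.ker_mk', Subgroup.map_comap_eq_self_of_surjective
      (QuotientGroup.mk'_surjective N), Nat.card_zpowers, hco] at h2
    rw [← h1, h2, mul_comm]

section Fixed

variable {V : Type} [AddCommGroup V] [Module ℂ V]

/-- The endomorphisms of a representation of `G` commuting with the action of a subgroup. -/
noncomputable def Representation.commutant (ρ : Representation ℂ G V) (N : Subgroup G) :
    Submodule ℂ (V →ₗ[ℂ] V) :=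
  invariants (MonoidHom.comp (linHom ρ ρ) N.subtype : Representation ℂ N (V →ₗ[ℂ] V))

namespace Representation

variable {ρ : Representation ℂ G V}

omit [Finite G] in
theorem mem_commutant {N : Subgroup G} {T : V →ₗ[ℂ] V} :
    T ∈ ρ.commutant N ↔ ∀ n ∈ N, linHom ρ ρ n T = T :=
  ⟨fun h n hn => h ⟨n, hn⟩, fun h n => h n n.2⟩

theorem card_mul_finrank_commutant [FiniteDimensional ℂ V] (N : Subgroup G) :
    (Nat.card N : ℝ) * finrank ℂ (ρ.commutant N) =
      ∑ᶠ g : G, if g ∈ N then ‖ρ.character g‖ ^ 2 else 0 := by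
  have := Fintype.ofFinite G
  have h := finrank_invariants
    (MonoidHom.comp (linHom ρ ρ) N.subtype : Representation ℂ N (V →ₗ[ℂ] V))
  rw [finsum_eq_sum_of_fintype] at h ⊢
  have hchar (n : N) : Representation.character (MonoidHom.comp (linHom ρ ρ) N.subtype) n =
      ((‖ρ.character n‖ ^ 2 : ℝ) : ℂ) := by
    have h1 := char_linHom ρ ρ (n : G)
    rw [← conj_character, mul_comm, Complex.mul_conj, Complex.normSq_eq_norm_sq] at h1
    exact h1
  rw [← Finset.sum_filter, Finset.sum_subtype (p := (· ∈ N)) _ (by simp)]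
  rw [eq_inv_mul_iff_mul_eq₀ (Nat.cast_ne_zero.2 Nat.card_pos.ne')] at h
  simp_rw [hchar] at h
  exact_mod_cast h

theorem card_mul_finrank_commutant_mono [FiniteDimensional ℂ V] {N M : Subgroup G} (h : N ≤ M) :
    Nat.card N * finrank ℂ (ρ.commutant N) ≤ Nat.card M * finrank ℂ (ρ.commutant M) := by
  have := Fintype.ofFinite G
  rify
  rw [card_mul_finrank_commutant, card_mul_finrank_commutant, finsum_eq_sum_of_fintype,
    finsum_eq_sum_of_fintype]
  refine Finset.sum_le_sum fun g _ => ?_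
  split_ifs with h1 h2
  · rfl
  · exact absurd (h h1) h2
  · positivity
  · rfl

omit [Finite G] in
theorem finrank_commutant_top [FiniteDimensional ℂ V] [IsIrreducible ρ] :
    finrank ℂ (ρ.commutant ⊤) = 1 := by
  rw [← IsIrreducible.finrank_intertwiningMap_self ρ,
    ← (invariantsEquivIntertwiningMap ρ ρ).finrank_eq]
  have : ρ.commutant ⊤ = (linHom ρ ρ).invariants := by
    ext T
    simp [mem_commutant]
  rw [this]

omit [Finite G] in
theorem finrank_commutant_bot [FiniteDimensional ℂ V] :
    finrank ℂ (ρ.commutant ⊥) = finrank ℂ V ^ 2 := by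
  have : ρ.commutant ⊥ = ⊤ := by
    ext T
    simp only [mem_commutant, Subgroup.mem_bot, forall_eq, Submodule.mem_top, iff_true]
    rw [map_one, Module.End.one_apply]
  rw [this, finrank_top, finrank_linearMap, sq]

/-- The constituents of `χ * conj χ` whose kernel contains `N`. -/
def constituentsAbove (ρ : Representation ℂ G V) (N : Subgroup G) : Set (G → ℂ) :=
  {θ ∈ constituents G (linHom ρ ρ).character | ∀ n ∈ N, θ n = θ 1}

theorem finite_constituentsAbove (ρ : Representation ℂ G V) (N : Subgroup G) :
    (ρ.constituentsAbove N).Finite :=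
  finite_setOf_isIrrChar.subset fun _ h => h.1.1

theorem one_le_ncard_constituentsAbove [FiniteDimensional ℂ V] [IsIrreducible ρ]
    (N : Subgroup G) : 1 ≤ (ρ.constituentsAbove N).ncard := by
  rw [Nat.one_le_iff_ne_zero, Ne, Set.ncard_eq_zero (ρ.finite_constituentsAbove N),
    ← Ne, ← Set.nonempty_iff_ne_empty]
  have := ρ.nontrivial_of_isIrreducible
  have h : Subrepresentation.eigen (linHom ρ ρ) ⊤ 1 (by simp) 1 ≠ ⊥ :=
    Subrepresentation.ne_bot_of_mem_s3 (v := LinearMap.id)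
      (Subrepresentation.mem_eigen.2 ⟨fun n _ => by ext; simp [linHom_apply], by simp⟩)
      (one_ne_zero (α := Module.End ℂ V))
  obtain ⟨θ, hθ, -, hθN, -⟩ := Subrepresentation.exists_constituent_of_eigen_ne_bot h
  exact ⟨θ, hθ, fun n _ => hθN n (Subgroup.mem_top n)⟩

theorem finrank_commutant_le_or_ncard_constituentsAbove_add_le [FiniteDimensional ℂ V]
    [IsIrreducible ρ] {p : ℕ} (hp : p.Prime) {N M : Subgroup G} [N.Normal] {z : G}
    (hzp : z ^ p ∈ N) (hz : ∀ g, z⁻¹ * g⁻¹ * z * g ∈ N) (hNM : N ≤ M) (hzM : z ∈ M)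
    (hM : ∀ x ∈ M, ∃ i : ℕ, ∃ n ∈ N, x = z ^ i * n) :
    finrank ℂ (ρ.commutant N) ≤ finrank ℂ (ρ.commutant M) ∨
      (ρ.constituentsAbove M).ncard + (p - 1) ≤ (ρ.constituentsAbove N).ncard := by
  by_cases hfix : ∀ T ∈ ρ.commutant N, linHom ρ ρ z T = T
  · left
    refine Submodule.finrank_mono fun T hT => mem_commutant.2 fun x hx => ?_
    obtain ⟨i, n, hn, rfl⟩ := hM x hx
    rw [map_mul, Module.End.mul_apply, mem_commutant.1 hT n hn, map_pow]
    clear * - hfix hT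
    induction i with
    | zero => simp
    | succ i ih => rw [pow_succ, Module.End.mul_apply, hfix T hT, ih]
  · right
    push Not at hfix
    obtain ⟨T, hT, hTz⟩ := hfix
    obtain ⟨ω, hωp, hω1, hω⟩ := Subrepresentation.exists_eigen_ne_bot hp hz hzp
      (mem_commutant.1 hT) hTz
    have hprim : IsPrimitiveRoot ω p := by
      have := Fact.mk hp
      exact IsPrimitiveRoot.iff_orderOf.2 (orderOf_eq_prime hωp hω1)
    choose θ hθ hθ0 hθN hθz using fun i =>
      Subrepresentation.exists_constituent_of_eigen_ne_bot (Subrepresentation.eigen_pow_ne_bot hω i)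
    have hinj : Set.InjOn θ (Finset.range (p - 1)) := by
      intro i hi j hj hij
      have h1 := hθz i
      rw [hij, hθz j] at h1
      have h2 := mul_right_cancel₀ (hθ0 j) h1
      have h3 := Finset.mem_range.1 hi
      have h4 := Finset.mem_range.1 hj
      have := hprim.pow_inj (by omega) (by omega) h2
      omega
    have hdisj : Disjoint (ρ.constituentsAbove M) (θ '' (Finset.range (p - 1))) := by
      rw [Set.disjoint_right]
      rintro _ ⟨i, hi, rfl⟩ h
      have h1 := h.2 z hzM
      rw [hθz] at h1
      have h2 := mul_right_cancel₀ (hθ0 i) (h1.trans (one_mul _).symm)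
      have h3 := Finset.mem_range.1 hi
      exact hprim.pow_ne_one_of_pos_of_lt (Nat.succ_ne_zero i) (by omega) h2
    calc (ρ.constituentsAbove M).ncard + (p - 1)
        = (ρ.constituentsAbove M ∪ θ '' (Finset.range (p - 1))).ncard := by
          rw [Set.ncard_union_eq hdisj (ρ.finite_constituentsAbove M)
            ((Finset.finite_toSet _).image _), hinj.ncard_image,
            Set.ncard_coe_finset, Finset.card_range]
      _ ≤ _ := by
          refine Set.ncard_le_ncard ?_ (ρ.finite_constituentsAbove N)
          rintro _ (h | ⟨i, -, rfl⟩)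
          · exact ⟨h.1, fun n hn => h.2 n (hNM hn)⟩
          · exact ⟨hθ i, hθN i⟩

theorem exists_finrank_commutant_le_pow [FiniteDimensional ℂ V] [IsIrreducible ρ] {p : ℕ}
    (hp : p.Prime) (hG : IsPGroup p G) (N : Subgroup G) [hN : N.Normal] :
    ∃ s, finrank ℂ (ρ.commutant N) ≤ p ^ s ∧
      (p - 1) * s + 1 ≤ (ρ.constituentsAbove N).ncard := by
  induction N using WellFoundedGT.induction generalizing hN with
  | ind N ih =>
  by_cases hNtop : N = ⊤
  · subst hNtop
    exact ⟨0, by rw [finrank_commutant_top, pow_zero], by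
      simpa using one_le_ncard_constituentsAbove (ρ := ρ) ⊤⟩
  obtain ⟨z, -, hzp, hz, M, hMn, hNM, hzM, hM, hcard⟩ := hG.exists_central_step hp hNtop
  obtain ⟨s, hs, hs'⟩ := ih M hNM (hN := hMn)
  rcases finrank_commutant_le_or_ncard_constituentsAbove_add_le (ρ := ρ) hp hzp hz hNM.le hzM hM
    with h | h
  · refine ⟨s, h.trans hs, hs'.trans ?_⟩
    exact Set.ncard_le_ncard (fun θ hθ => ⟨hθ.1, fun n hn => hθ.2 n (hNM.le hn)⟩)
      (ρ.finite_constituentsAbove N)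
  · refine ⟨s + 1, ?_, by rw [mul_add]; omega⟩
    have h1 := card_mul_finrank_commutant_mono (ρ := ρ) hNM.le
    rw [hcard, mul_comm p, mul_assoc] at h1
    refine (le_of_mul_le_mul_left h1 Nat.card_pos).trans ?_
    rw [pow_succ']
    exact Nat.mul_le_mul_left p hs

theorem two_mul_sub_one_add_one_le_ncard_constituents [FiniteDimensional ℂ V] [IsIrreducible ρ]
    {p n : ℕ} (hp : p.Prime) (hG : IsPGroup p G) (hV : finrank ℂ V = p ^ n) :
    2 * n * (p - 1) + 1 ≤ (constituents G (linHom ρ ρ).character).ncard := by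
  obtain ⟨s, hs, hs'⟩ := exists_finrank_commutant_le_pow (ρ := ρ) hp hG ⊥
  rw [finrank_commutant_bot, hV, ← pow_mul] at hs
  have hns : n * 2 ≤ s := (Nat.pow_le_pow_iff_right hp.one_lt).1 hs
  have hsub : ρ.constituentsAbove ⊥ ⊆ constituents G (linHom ρ ρ).character := fun θ h => h.1
  have := Set.ncard_le_ncard hsub (finite_setOf_isIrrChar.subset fun _ h => h.1)
  have : 2 * n * (p - 1) ≤ (p - 1) * s := by
    rw [mul_comm, mul_comm 2 n]
    exact Nat.mul_le_mul_left _ hns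
  omega

end Representation

end Fixed

theorem charInner_mul_right_cancel {α : G → ℂ} (hα : ∀ g, α g * (starRingEnd ℂ) (α g) = 1)
    (φ ψ : G → ℂ) : charInner G (φ * α) (ψ * α) = charInner G φ ψ := by
  have := Fintype.ofFinite G
  simp only [charInner, finsum_eq_sum_of_fintype, Pi.mul_apply, map_mul]
  congr 1
  refine Finset.sum_congr rfl fun g _ => ?_
  linear_combination (φ g * (starRingEnd ℂ) (ψ g)) * hα g

theorem Representation.character_mul_conj_of_finrank_eq_one {A : Type} [AddCommGroup A]
    [Module ℂ A] [FiniteDimensional ℂ A] (σ : Representation ℂ G A) (h : finrank ℂ A = 1) (g : G) :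
    σ.character g * (starRingEnd ℂ) (σ.character g) = 1 := by
  have hs (f : A →ₗ[ℂ] A) : f = LinearMap.trace ℂ A f • LinearMap.id := by
    obtain ⟨c, hc, -⟩ := LinearMap.existsUnique_eq_smul_id_of_finrank_eq_one h f
    rw [hc]
    simp [h]
  have h1 : σ g⁻¹ = σ.character g⁻¹ • LinearMap.id := hs _
  have h2 : LinearMap.trace ℂ A (σ g * σ g⁻¹) = 1 := by
    rw [← map_mul, mul_inv_cancel, map_one, LinearMap.trace_one, h, Nat.cast_one]
  rw [conj_character, ← h2, h1, mul_comm]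
  change _ = LinearMap.trace ℂ A (σ g ∘ₗ _)
  rw [LinearMap.comp_smul, LinearMap.comp_id, map_smul, smul_eq_mul]
  rfl

end Characters

/-- **Corollary.** Let `p` be a prime, `G` a finite `p`-group, `χ, ψ ∈ Irr(G)` with
`χ(1) = p ^ n`. If there is a linear character `α` of `G` with `[α, χψ] ≠ 0`, then
`η(χ, ψ) ≥ 2n(p-1) + 1`. -/
theorem eta_ge_of_linear_constituent {p n : ℕ} (hp : p.Prime)
    (G : Type) [Group G] [Finite G] (hG : IsPGroup p G)
    (χ ψ : G → ℂ) (hχ : IsIrrChar G χ) (hψ : IsIrrChar G ψ)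
    (hdeg : χ 1 = (p : ℂ) ^ n)
    (α : G → ℂ) (hα : IsIrrChar G α) (hα1 : α 1 = 1)
    (hconst : charInner G α (χ * ψ) ≠ 0) :
    2 * n * (p - 1) + 1 ≤ eta G χ ψ := by
  obtain ⟨V, _, _, _, ρ, hρ, rfl⟩ := hχ.exists_representation
  obtain ⟨A, _, _, _, σ, hσ, rfl⟩ := hα.exists_representation
  have hV : finrank ℂ V = p ^ n := by
    rw [char_one] at hdeg
    exact_mod_cast hdeg
  have hA : finrank ℂ A = 1 := by
    rw [char_one] at hα1
    exact_mod_cast hα1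
  have hσ1 := σ.character_mul_conj_of_finrank_eq_one hA
  have hτ : (linHom ρ σ).character = conjChar ρ.character * σ.character := by
    ext g
    rw [char_linHom, Pi.mul_apply, conjChar, conj_character]
  have hτirr : IsIrrChar G (linHom ρ σ).character := by
    refine isIrrChar_of_charInner_self _ ?_
    rw [hτ, charInner_mul_right_cancel hσ1, ← hχ.charInner_self]
    simp [charInner, conjChar, mul_comm]
  have hψτ : (linHom ρ σ).character = ψ := by
    refine hτirr.eq_of_charInner_ne_zero hψ ?_
    rw [hτ]
    convert hconst using 1
    simp [charInner, conjChar, mul_comm, mul_left_comm]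
  have hprod : ρ.character * ψ = (linHom ρ ρ).character * σ.character := by
    ext g
    rw [← hψτ]
    simp only [Pi.mul_apply, char_linHom]
    ring
  refine (two_mul_sub_one_add_one_le_ncard_constituents (ρ := ρ) hp hG hV).trans ?_
  refine Set.ncard_le_ncard_of_injOn (· * σ.character) ?_ ?_
    (finite_setOf_isIrrChar.subset fun _ h => h.1)
  · rintro θ ⟨hθ, hθ0⟩
    refine ⟨?_, ?_⟩
    · obtain ⟨W, _, _, _, κ, hκ, rfl⟩ := hθ.exists_representation
      have h := isIrrChar_of_charInner_self (tprod κ σ)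
      rw [char_tensor, charInner_mul_right_cancel hσ1] at h
      exact h hθ.charInner_self
    · rwa [hprod, charInner_mul_right_cancel hσ1]
  · intro θ _ θ' _ h
    ext g
    exact mul_right_cancel₀ (left_ne_zero_of_mul_eq_one (hσ1 g)) (congrFun h g)
end

section
/- Let p be a prime, G a finite p-group, and χ ∈ Irr(G). Let N be a normal subgroup of G and ν ∈ Irr(N) with (N, ν) < (G, χ). Let M/N be a chief factor of G and assume M ∩ G_ν = N. Set μ = ν^M (the induced character). Then μ ∈ Irr(M), G_μ = G_ν·M, (M, μ) ≤ (G, χ), and every irreducible constituent of (1_N)^M is an irreducible constituent of χχ̄. -/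
open scoped Classical

open CategoryTheory Module

lemma charInner_eq_sum {G : Type} [Group G] [Fintype G] (φ ψ : G → ℂ) :
    charInner G φ ψ = (Nat.card G : ℂ)⁻¹ * ∑ g : G, φ g * (starRingEnd ℂ) (ψ g) := by
  rw [charInner, finsum_eq_sum_of_fintype]

lemma charInner_add_left {G : Type} [Group G] [Finite G] (φ₁ φ₂ ψ : G → ℂ) :
    charInner G (φ₁ + φ₂) ψ = charInner G φ₁ ψ + charInner G φ₂ ψ := by
  have := Fintype.ofFinite G
  simp [charInner_eq_sum, add_mul, Finset.sum_add_distrib, mul_add]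

lemma charInner_conj_symm {G : Type} [Group G] [Finite G] (φ ψ : G → ℂ) :
    (starRingEnd ℂ) (charInner G φ ψ) = charInner G ψ φ := by
  have := Fintype.ofFinite G
  simp [charInner_eq_sum, map_sum, mul_comm]

lemma charInner_add_right {G : Type} [Group G] [Finite G] (φ ψ₁ ψ₂ : G → ℂ) :
    charInner G φ (ψ₁ + ψ₂) = charInner G φ ψ₁ + charInner G φ ψ₂ := by
  rw [← charInner_conj_symm, charInner_add_left, map_add, charInner_conj_symm, charInner_conj_symm]

lemma charInner_comp_mulEquiv {A B : Type} [Group A] [Group B] (e : A ≃* B) (φ ψ : B → ℂ) :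
    charInner A (φ ∘ e) (ψ ∘ e) = charInner B φ ψ := by
  unfold charInner
  rw [Nat.card_congr e.toEquiv,
    ← finsum_comp_equiv e.toEquiv (f := fun b => φ b * (starRingEnd ℂ) (ψ b))]
  rfl

open scoped ComplexOrder in
/-- Over `ℂ`, a representation of a finite group satisfies `tr (ρ g⁻¹) = conj (tr (ρ g))`. -/
lemma trace_inv_eq_conj {G V : Type*} [Group G] [Finite G] [AddCommGroup V] [Module ℂ V]
    [FiniteDimensional ℂ V] (ρ : Representation ℂ G V) (g : G) :
    ρ.character g⁻¹ = (starRingEnd ℂ) (ρ.character g) := by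
  have := Fintype.ofFinite G
  let b := Module.finBasis ℂ V
  let A : G → Matrix _ _ ℂ := fun g => LinearMap.toMatrix b b (ρ g)
  have hmul : ∀ x y, A (x * y) = A x * A y := fun x y => by
    simp only [A, map_mul, LinearMap.toMatrix_mul]
  have hone : A 1 = 1 := by simp only [A, map_one, LinearMap.toMatrix_one]
  have htr : ∀ x, ρ.character x = (A x).trace := fun x =>
    LinearMap.trace_eq_matrix_trace ℂ b _
  let P := ∑ h, (A h).conjTranspose * A h
  have hP : P.PosDef := by
    have : P = (∑ h ∈ Finset.univ.erase 1, (A h).conjTranspose * A h) + 1 := by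
      simp only [P]
      rw [← Finset.sum_erase_add _ _ (Finset.mem_univ (1 : G)), hone]
      simp
    rw [this]
    exact Matrix.PosDef.posSemidef_add
      (Matrix.posSemidef_sum _ fun h _ => Matrix.posSemidef_conjTranspose_mul_self _)
      Matrix.PosDef.one
  have hinv : (A g).conjTranspose * P * A g = P := by
    simp only [P, Finset.mul_sum, Finset.sum_mul]
    refine Fintype.sum_equiv (Equiv.mulRight g) _ _ fun h => ?_
    simp only [Equiv.coe_mulRight, hmul, Matrix.conjTranspose_mul, Matrix.mul_assoc]
  have hAA : A g * A g⁻¹ = 1 := by rw [← hmul, mul_inv_cancel, hone]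
  have hPA : P * A g⁻¹ = (A g).conjTranspose * P := by
    calc P * A g⁻¹ = (A g).conjTranspose * P * A g * A g⁻¹ := by rw [hinv]
      _ = _ := by rw [Matrix.mul_assoc, hAA, Matrix.mul_one]
  have hu : IsUnit P.det := (Matrix.isUnit_iff_isUnit_det P).1 hP.isUnit
  have : A g⁻¹ = P⁻¹ * ((A g).conjTranspose * P) := by
    rw [← hPA, ← Matrix.mul_assoc, Matrix.nonsing_inv_mul _ hu, Matrix.one_mul]
  rw [htr, htr, this, Matrix.trace_mul_comm, Matrix.mul_assoc, Matrix.mul_nonsing_inv _ hu,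
    Matrix.mul_one, Matrix.trace_conjTranspose]
  rfl

/-- `φ` is the character of some finite-dimensional complex representation of `G`. -/
def IsCharacter (G : Type) [Group G] (φ : G → ℂ) : Prop :=
  ∃ V : FDRep ℂ G, V.character = φ

lemma IsIrrChar.isCharacter {G : Type} [Group G] {φ : G → ℂ} (h : IsIrrChar G φ) :
    IsCharacter G φ := by
  obtain ⟨V, -, hV⟩ := h
  exact ⟨V, hV⟩

lemma Representation.isCharacter {G V : Type} [Group G] [AddCommGroup V] [Module ℂ V]
    [FiniteDimensional ℂ V] (ρ : Representation ℂ G V) : IsCharacter G ρ.character :=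
  ⟨FDRep.of ρ, rfl⟩

namespace IsCharacter

variable {G : Type} [Group G] {φ ψ : G → ℂ}

lemma exists_representation (h : IsCharacter G φ) :
    ∃ (V : Type) (_ : AddCommGroup V) (_ : Module ℂ V) (_ : FiniteDimensional ℂ V)
      (ρ : Representation ℂ G V), ρ.character = φ := by
  obtain ⟨V, hV⟩ := h
  exact ⟨V, inferInstance, inferInstance, inferInstance, V.ρ, hV⟩

lemma map_inv [Finite G] (h : IsCharacter G φ) (g : G) : φ g⁻¹ = (starRingEnd ℂ) (φ g) := by
  obtain ⟨V, rfl⟩ := h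
  exact trace_inv_eq_conj V.ρ g

lemma map_conj (h : IsCharacter G φ) (x g : G) : φ (x * g * x⁻¹) = φ g := by
  obtain ⟨V, rfl⟩ := h
  exact V.char_conj g x

lemma mul (hφ : IsCharacter G φ) (hψ : IsCharacter G ψ) : IsCharacter G (φ * ψ) := by
  obtain ⟨V, _, _, _, ρ, rfl⟩ := hφ.exists_representation
  obtain ⟨W, _, _, _, σ, rfl⟩ := hψ.exists_representation
  rw [← Representation.char_tensor]
  exact Representation.isCharacter _

lemma add (hφ : IsCharacter G φ) (hψ : IsCharacter G ψ) : IsCharacter G (φ + ψ) := by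
  obtain ⟨V, _, _, _, ρ, rfl⟩ := hφ.exists_representation
  obtain ⟨W, _, _, _, σ, rfl⟩ := hψ.exists_representation
  convert (ρ.prod σ).isCharacter using 1
  ext g
  exact (LinearMap.trace_prodMap' (ρ g) (σ g)).symm

lemma comp (hφ : IsCharacter G φ) {H : Type} [Group H] (f : H →* G) :
    IsCharacter H (φ ∘ f) := by
  obtain ⟨V, _, _, _, ρ, rfl⟩ := hφ.exists_representation
  exact Representation.isCharacter (MonoidHom.comp ρ f)

lemma zero : IsCharacter G (0 : G → ℂ) := by
  convert (1 : Representation ℂ G (Fin 0 → ℂ)).isCharacter using 1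
  ext g
  simp [Representation.character]

lemma exists_charInner_eq_natCast [Finite G] (hφ : IsCharacter G φ) (hψ : IsCharacter G ψ) :
    ∃ n : ℕ, charInner G φ ψ = n := by
  have := Fintype.ofFinite G
  have : Invertible (Nat.card G : ℂ) := invertibleOfNonzero (by simp)
  rw [charInner_eq_sum]
  simp_rw [← hψ.map_inv]
  obtain ⟨V, rfl⟩ := hφ
  obtain ⟨W, rfl⟩ := hψ
  exact ⟨_, FDRep.scalar_product_char_eq_finrank_equivariant W V⟩

lemma isIrrChar_iff [Finite G] (hφ : IsCharacter G φ) :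
    IsIrrChar G φ ↔ charInner G φ φ = 1 := by
  have := Fintype.ofFinite G
  have key : ∀ V : FDRep ℂ G, Simple V ↔ charInner G V.character V.character = 1 := fun V => by
    rw [FDRep.simple_iff_char_is_norm_one, charInner_eq_sum,
      inv_mul_eq_one₀ (by exact_mod_cast Nat.card_pos.ne')]
    simp_rw [IsCharacter.map_inv ⟨V, rfl⟩]
    exact eq_comm
  obtain ⟨V, rfl⟩ := hφ
  refine ⟨?_, fun h => ⟨V, (key V).2 h, rfl⟩⟩
  rintro ⟨W, hW, h⟩
  rw [← h, (key W).1 hW]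

end IsCharacter

namespace IsIrrChar

variable {G : Type} [Group G] {φ ψ : G → ℂ}

lemma charInner_self_s8 [Finite G] (hφ : IsIrrChar G φ) : charInner G φ φ = 1 :=
  hφ.isCharacter.isIrrChar_iff.1 hφ

lemma eq_of_charInner_ne_zero_s8 [Finite G] (hφ : IsIrrChar G φ) (hψ : IsIrrChar G ψ)
    (h : charInner G φ ψ ≠ 0) : φ = ψ := by
  have := Fintype.ofFinite G
  have : Invertible (Nat.card G : ℂ) := invertibleOfNonzero (by simp)
  rw [charInner_eq_sum] at h
  simp_rw [← hψ.isCharacter.map_inv] at h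
  obtain ⟨V, _, rfl⟩ := hφ
  obtain ⟨W, _, rfl⟩ := hψ
  rw [FDRep.char_orthonormal] at h
  by_contra hne
  exact h (if_neg fun ⟨i⟩ => hne (FDRep.char_iso i))

lemma comp_mulEquiv [Finite G] (hφ : IsIrrChar G φ) {H : Type} [Group H] (e : H ≃* G) :
    IsIrrChar H (φ ∘ e) := by
  have := Finite.of_equiv _ e.symm.toEquiv
  refine (hφ.isCharacter.comp e.toMonoidHom).isIrrChar_iff.2 ?_
  exact (charInner_comp_mulEquiv e φ φ).trans hφ.charInner_self_s8

end IsIrrChar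

namespace Representation

variable {G V : Type} [Group G] [AddCommGroup V] [Module ℂ V] [FiniteDimensional ℂ V]

lemma charInner_character_self [Finite G] (ρ : Representation ℂ G V) :
    charInner G ρ.character ρ.character = finrank ℂ (IntertwiningMap ρ ρ) := by
  have := Fintype.ofFinite G
  have : Invertible (Nat.card G : ℂ) := invertibleOfNonzero (by simp)
  rw [charInner_eq_sum, ← card_inv_mul_sum_char_mul_char_eq_finrank]
  simp_rw [ρ.isCharacter.map_inv]

lemma isIrrChar_of_isIrreducible [Finite G] (ρ : Representation ℂ G V) [ρ.IsIrreducible] :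
    IsIrrChar G ρ.character := by
  rw [ρ.isCharacter.isIrrChar_iff, charInner_character_self,
    IsIrreducible.finrank_intertwiningMap_self, Nat.cast_one]

lemma character_eq_add_of_isCompl (ρ : Representation ℂ G V) {σ τ : Subrepresentation ρ}
    (h : IsCompl σ.toSubmodule τ.toSubmodule) :
    ρ.character = σ.toRepresentation.character + τ.toRepresentation.character := by
  ext g
  have := LinearMap.trace_conj' (LinearMap.prodMap (σ.toRepresentation g) (τ.toRepresentation g))
    (Submodule.prodEquivOfIsCompl _ _ h)
  rw [LinearMap.trace_prodMap'] at this
  rw [Pi.add_apply, character, character, character, ← this]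
  congr 1
  ext v
  obtain ⟨⟨x, y⟩, rfl⟩ := (Submodule.prodEquivOfIsCompl _ _ h).surjective v
  rw [LinearEquiv.conj_apply_apply, LinearEquiv.symm_apply_apply]
  simp [Subrepresentation.toRepresentation]

/-- A complex representation of a finite group that is not irreducible is zero or the sum of two
subrepresentations of smaller dimension. -/
lemma exists_isCompl_of_not_isIrreducible [Finite G] [Nontrivial V] (ρ : Representation ℂ G V)
    (h : ¬ ρ.IsIrreducible) :
    ∃ σ τ : Subrepresentation ρ, IsCompl σ.toSubmodule τ.toSubmodule ∧
      finrank ℂ σ.toSubmodule < finrank ℂ V ∧ finrank ℂ τ.toSubmodule < finrank ℂ V := by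
  have : Nontrivial (Subrepresentation ρ) :=
    ⟨⊥, ⊤, fun h => bot_ne_top (congrArg Subrepresentation.toSubmodule h)⟩
  obtain ⟨σ, hbot, htop⟩ : ∃ σ : Subrepresentation ρ, σ ≠ ⊥ ∧ σ ≠ ⊤ := by
    by_contra! hσ
    exact h ⟨fun σ => or_iff_not_imp_left.2 (hσ σ)⟩
  obtain ⟨τ, hτ⟩ := exists_isCompl σ
  have hbot' : σ.toSubmodule ≠ ⊥ := fun h => hbot (Subrepresentation.toSubmodule_injective h)
  have htop' : σ.toSubmodule ≠ ⊤ := fun h => htop (Subrepresentation.toSubmodule_injective h)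
  have hc : IsCompl σ.toSubmodule τ.toSubmodule :=
    ⟨disjoint_iff.2 (congrArg Subrepresentation.toSubmodule hτ.inf_eq_bot),
      codisjoint_iff.2 (congrArg Subrepresentation.toSubmodule hτ.sup_eq_top)⟩
  refine ⟨σ, τ, hc, Submodule.finrank_lt htop', Submodule.finrank_lt fun h => hbot' ?_⟩
  simpa [h] using hc.inf_eq_bot

lemma exists_isIrrChar_add [Finite G] (S : (G → ℂ) → ℂ) (hS : ∀ φ ψ, S (φ + ψ) = S φ + S ψ)
    (ρ : Representation ℂ G V) (hρ : S ρ.character ≠ 0) :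
    ∃ θ κ, IsIrrChar G θ ∧ IsCharacter G κ ∧ ρ.character = θ + κ ∧ S θ ≠ 0 := by
  induction hn : finrank ℂ V using Nat.strong_induction_on generalizing V with
  | _ n ih =>
  by_cases hirr : ρ.IsIrreducible
  · exact ⟨_, 0, ρ.isIrrChar_of_isIrreducible, .zero, (add_zero _).symm, hρ⟩
  have : Nontrivial V := by
    by_contra hV
    rw [not_nontrivial_iff_subsingleton] at hV
    have h0 : ρ.character = 0 := by
      ext g
      simp [character, Subsingleton.elim (ρ g) 0]
    have := hS 0 0
    rw [h0] at hρ
    simp_all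
  obtain ⟨σ, τ, h, hσ, hτ⟩ := ρ.exists_isCompl_of_not_isIrreducible hirr
  have hsum := ρ.character_eq_add_of_isCompl h
  rw [hsum, hS] at hρ
  by_cases h1 : S σ.toRepresentation.character = 0
  · rw [h1, zero_add] at hρ
    obtain ⟨θ, κ, hθ, hκ, heq, hne⟩ := ih _ (hn ▸ hτ) τ.toRepresentation hρ rfl
    exact ⟨θ, _, hθ, σ.toRepresentation.isCharacter.add hκ, by rw [hsum, heq, add_left_comm], hne⟩
  · obtain ⟨θ, κ, hθ, hκ, heq, hne⟩ := ih _ (hn ▸ hσ) σ.toRepresentation h1 rfl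
    exact ⟨θ, _, hθ, hκ.add τ.toRepresentation.isCharacter, by rw [hsum, heq, add_assoc], hne⟩

end Representation

/-- If the restriction of an irreducible character to a normal subgroup contains the trivial
character, then the normal subgroup lies in its kernel. -/
lemma IsIrrChar.apply_eq_of_charInner_one_ne_zero {G : Type} [Group G] [Finite G] {θ : G → ℂ}
    (hθ : IsIrrChar G θ) (H : Subgroup G) [H.Normal] (h : charInner H (resChar H θ) 1 ≠ 0) :
    θ 1 ≠ 0 ∧ ∀ n ∈ H, ∀ g, θ (n * g) = θ g := by
  have := Fintype.ofFinite G
  have := Fintype.ofFinite H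
  obtain ⟨V, _, _, _, ρ, rfl⟩ := hθ.isCharacter.exists_representation
  have hrank : finrank ℂ (ρ.IntertwiningMap ρ) = 1 := by
    have := hθ.charInner_self_s8
    rw [ρ.charInner_character_self] at this
    exact_mod_cast this
  let ρH : Representation ℂ H V := MonoidHom.comp ρ H.subtype
  let P : ρ.IntertwiningMap ρ := ⟨∑ n : H, ρ n, fun g => by
    change (∑ n : H, ρ n) * ρ g = ρ g * ∑ n : H, ρ n
    rw [Finset.sum_mul, Finset.mul_sum]
    refine Fintype.sum_equiv (MulAut.conjNormal g⁻¹).toEquiv _ _ fun n => ?_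
    simp [← map_mul, mul_assoc]⟩
  have hP : P.toLinearMap = ∑ n : H, ρ n := rfl
  obtain ⟨c, hc⟩ : ∃ c : ℂ, c • Representation.IntertwiningMap.id ρ = P := by
    refine (finrank_eq_one_iff_of_nonzero' _ fun h0 => ?_).1 hrank P
    have : Subsingleton (ρ.IntertwiningMap ρ) := ⟨fun f g => by
      ext v
      have hv : v = 0 := DFunLike.congr_fun h0 v
      simp [hv]⟩
    simp [finrank_zero_of_subsingleton] at hrank
  have hcl : ∑ n : H, ρ n = c • 1 := by
    rw [← hP, ← hc]
    rfl
  have htr : c * ρ.character 1 ≠ 0 := by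
    have htr' : c * ρ.character 1 = ∑ n : H, ρ.character n := by
      simpa [Representation.character] using (congrArg (LinearMap.trace ℂ V) hcl).symm
    rw [htr']
    rw [charInner_eq_sum] at h
    simpa [resChar] using right_ne_zero_of_mul h
  refine ⟨right_ne_zero_of_mul htr, fun n hn g => ?_⟩
  have hn1 : ρ n = 1 := by
    have : ρ n * ∑ n : H, ρ n = ∑ n : H, ρ n := by
      rw [Finset.mul_sum]
      refine Fintype.sum_equiv (Equiv.mulLeft ⟨n, hn⟩) _ _ fun m => ?_
      simp
    rw [hcl, mul_smul_comm, mul_one] at this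
    exact smul_right_injective _ (left_ne_zero_of_mul htr) this
  simp [Representation.character, hn1]

section Induced

variable {G : Type} [Group G]

lemma indChar_conj (H : Subgroup G) (γ : H → ℂ) (x g : G) :
    indChar H γ (x * g * x⁻¹) = indChar H γ g := by
  unfold indChar
  congr 1
  rw [← finsum_comp_equiv (Equiv.mulRight x)
    (f := fun y => if h : y * g * y⁻¹ ∈ H then γ ⟨y * g * y⁻¹, h⟩ else 0)]
  refine finsum_congr fun y => ?_
  simp [mul_assoc]

lemma indChar_apply_of_mem [Fintype G] (H : Subgroup G) [H.Normal] (γ : H → ℂ) (n : H) :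
    indChar H γ n = (Nat.card H : ℂ)⁻¹ * ∑ x : G, γ (MulAut.conjNormal x n) := by
  rw [indChar, finsum_eq_sum_of_fintype]
  congr 1
  refine Finset.sum_congr rfl fun x _ => ?_
  rw [dif_pos (Subgroup.Normal.conj_mem ‹_› _ n.2 x)]
  congr 1

lemma indChar_apply_of_notMem (H : Subgroup G) [H.Normal] (γ : H → ℂ) {g : G} (hg : g ∉ H) :
    indChar H γ g = 0 := by
  have : ∀ x : G, x * g * x⁻¹ ∉ H := fun x hx =>
    hg (by simpa [mul_assoc] using ‹H.Normal›.conj_mem _ hx x⁻¹)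
  simp [indChar, this]

/-- Frobenius reciprocity for class functions. -/
lemma charInner_indChar [Finite G] (H : Subgroup G) (γ : H → ℂ) {ψ : G → ℂ}
    (hψ : ∀ x g, ψ (x * g * x⁻¹) = ψ g) :
    charInner G (indChar H γ) ψ = charInner H γ (resChar H ψ) := by
  have := Fintype.ofFinite G
  have := Fintype.ofFinite H
  rw [charInner_eq_sum, charInner_eq_sum]
  have key : ∀ x : G, ∑ g : G, (if h : x * g * x⁻¹ ∈ H then γ ⟨x * g * x⁻¹, h⟩ else 0) *
      (starRingEnd ℂ) (ψ g) = ∑ n : H, γ n * (starRingEnd ℂ) (ψ n) := fun x => by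
    calc _ = ∑ g : G, (if h : g ∈ H then γ ⟨g, h⟩ else 0) * (starRingEnd ℂ) (ψ g) := by
          refine Fintype.sum_equiv (MulAut.conj x).toEquiv _ _ fun g => ?_
          change _ = _ * (starRingEnd ℂ) (ψ (x * g * x⁻¹))
          rw [hψ]
          rfl
      _ = _ := by
          rw [← Finset.sum_subset (Finset.subset_univ (Finset.univ.filter (· ∈ H)))
            (fun g _ hg => by simp at hg; simp [hg])]
          rw [Finset.sum_subtype (p := (· ∈ H)) _ (by simp)]
          exact Finset.sum_congr rfl fun n _ => by simp
  simp only [indChar, finsum_eq_sum_of_fintype, mul_assoc (_ : ℂ), Finset.sum_mul, ← Finset.mul_sum]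
  rw [Finset.sum_comm]
  simp only [key, resChar, Finset.sum_const, Finset.card_univ, nsmul_eq_mul,
    ← Nat.card_eq_fintype_card]
  have : (Nat.card G : ℂ) ≠ 0 := by exact_mod_cast Nat.card_pos.ne'
  field_simp

lemma charInner_resChar_indChar [Fintype G] (H : Subgroup G) [H.Normal] (δ γ : H → ℂ) :
    charInner H δ (resChar H (indChar H γ)) =
      (Nat.card H : ℂ)⁻¹ * ∑ x : G, charInner H δ (γ ∘ MulAut.conjNormal x) := by
  have := Fintype.ofFinite H
  simp only [charInner_eq_sum, resChar, indChar_apply_of_mem, map_mul, map_inv₀, map_natCast,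
    map_sum, Function.comp_apply, Finset.mul_sum]
  rw [Finset.sum_comm]
  refine Finset.sum_congr rfl fun x _ => Finset.sum_congr rfl fun n _ => ?_
  ring

/-- Clifford: an irreducible character whose stabilizer is `H` induces to norm one. -/
lemma charInner_indChar_self [Finite G] (H : Subgroup G) [H.Normal] {γ : H → ℂ}
    (hγ : IsIrrChar H γ)
    (hstab : ∀ x : G, γ ∘ MulAut.conjNormal x = γ → x ∈ H) :
    charInner G (indChar H γ) (indChar H γ) = 1 := by
  have := Fintype.ofFinite G
  rw [charInner_indChar H γ (indChar_conj H γ), charInner_resChar_indChar]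
  have key : ∀ x : G, charInner H γ (γ ∘ MulAut.conjNormal x) = if x ∈ H then 1 else 0 := by
    intro x
    split_ifs with hx
    · have : γ ∘ MulAut.conjNormal x = γ := funext fun n => by
        rw [← hγ.isCharacter.map_conj ⟨x, hx⟩ n]
        rfl
      rw [this, hγ.charInner_self_s8]
    · by_contra hne
      exact hx (hstab x (hγ.eq_of_charInner_ne_zero_s8 (hγ.comp_mulEquiv _) hne).symm)
  simp_rw [key]
  rw [Finset.sum_boole, ← Fintype.card_subtype, ← Nat.card_eq_fintype_card]
  exact inv_mul_cancel₀ (by exact_mod_cast (Nat.card_pos (α := H)).ne')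

lemma eq_of_charInner_eq_natCast [Finite G] {φ ψ : G → ℂ} (hφ : charInner G φ φ = 1) (hψ : charInner G ψ ψ = 1)
    {n : ℕ} (hn : n ≠ 0) (h : charInner G φ ψ = n) : φ = ψ := by
  have := Fintype.ofFinite G
  have h' : charInner G ψ φ = n := by rw [← charInner_conj_symm, h, Complex.conj_natCast]
  have hcard : (0 : ℝ) < Nat.card G := by exact_mod_cast Nat.card_pos
  have hexp : charInner G φ φ + charInner G ψ ψ - charInner G φ ψ - charInner G ψ φ =
      (((Nat.card G : ℝ)⁻¹ * ∑ g : G, Complex.normSq (φ g - ψ g) : ℝ) : ℂ) := by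
    simp only [charInner_eq_sum, ← mul_add, ← mul_sub, ← Finset.sum_add_distrib,
      ← Finset.sum_sub_distrib]
    push_cast
    congr 1
    refine Finset.sum_congr rfl fun g _ => ?_
    rw [← Complex.mul_conj, map_sub]
    ring
  rw [hφ, hψ, h, h'] at hexp
  have hreal : (1 + 1 - n - n : ℝ) =
      (Nat.card G : ℝ)⁻¹ * ∑ g : G, Complex.normSq (φ g - ψ g) := by exact_mod_cast hexp
  have hn1 : (1 : ℝ) ≤ n := by exact_mod_cast Nat.one_le_iff_ne_zero.2 hn
  have hnonneg : ∀ g ∈ Finset.univ, 0 ≤ Complex.normSq (φ g - ψ g) :=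
    fun g _ => Complex.normSq_nonneg _
  have hzero : ∑ g : G, Complex.normSq (φ g - ψ g) = 0 := by
    refine le_antisymm ?_ (Finset.sum_nonneg hnonneg)
    by_contra! hpos
    have := mul_pos (inv_pos.2 hcard) hpos
    linarith
  ext g
  have := (Finset.sum_eq_zero_iff_of_nonneg hnonneg).1 hzero g (Finset.mem_univ g)
  exact sub_eq_zero.1 (Complex.normSq_eq_zero.1 this)

/-- If the stabilizer of `γ` is `H` and `γ` lies under the character `φ`, then the induced
character of `γ` is an irreducible summand of `φ`. -/
lemma isIrrChar_indChar_and_exists_add [Finite G] (H : Subgroup G) [H.Normal]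
    {γ : H → ℂ} (hγ : IsIrrChar H γ) (hstab : ∀ x : G, γ ∘ MulAut.conjNormal x = γ → x ∈ H)
    {φ : G → ℂ} (hφ : IsCharacter G φ) (h : charInner H γ (resChar H φ) ≠ 0) :
    IsIrrChar G (indChar H γ) ∧ ∃ κ, IsCharacter G κ ∧ φ = indChar H γ + κ := by
  obtain ⟨V, _, _, _, ρ, rfl⟩ := hφ.exists_representation
  obtain ⟨θ, κ, hθ, hκ, heq, hne⟩ := ρ.exists_isIrrChar_add
    (fun ψ => charInner H γ (resChar H ψ)) (fun _ _ => charInner_add_right _ _ _) h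
  obtain ⟨n, hn⟩ := hγ.isCharacter.exists_charInner_eq_natCast
    (hθ.isCharacter.comp H.subtype)
  have hn' : charInner H γ (resChar H θ) = n := hn
  have hθeq : indChar H γ = θ := by
    refine eq_of_charInner_eq_natCast (charInner_indChar_self H hγ hstab) hθ.charInner_self_s8
      (n := n) ?_ ((charInner_indChar H γ hθ.isCharacter.map_conj).trans hn')
    rintro rfl
    exact hne (by simpa using hn')
  rw [hθeq]
  exact ⟨hθ, κ, hκ, heq⟩

lemma charInner_smul_left [Finite G] (c : ℂ) (φ ψ : G → ℂ) :
    charInner G (c • φ) ψ = c * charInner G φ ψ := by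
  have := Fintype.ofFinite G
  simp only [charInner_eq_sum, Pi.smul_apply, smul_eq_mul, Finset.mul_sum]
  exact Finset.sum_congr rfl fun g _ => by ring

lemma charInner_mul_conjChar (θ φ : G → ℂ) :
    charInner G θ (φ * conjChar φ) = charInner G (θ * φ) φ := by
  simp only [charInner, conjChar, Pi.mul_apply, map_mul, Complex.conj_conj]
  congr 1
  exact finsum_congr fun g => by ring

/-- An irreducible constituent `θ` of `(1_H)^G` is a constituent of `φ φ̄` whenever `φ` has an
irreducible summand induced from the normal subgroup `H`. -/
lemma charInner_mul_conjChar_ne_zero [Finite G] (H : Subgroup G) [H.Normal] {γ : H → ℂ}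
    (hμ : IsIrrChar G (indChar H γ)) {κ : G → ℂ} (hκ : IsCharacter G κ) {θ : G → ℂ}
    (hθ : IsIrrChar G θ) (h : charInner G θ (indChar H 1) ≠ 0) :
    charInner G θ ((indChar H γ + κ) * conjChar (indChar H γ + κ)) ≠ 0 := by
  have h1 : charInner H (resChar H θ) 1 ≠ 0 := by
    rw [← charInner_conj_symm, charInner_indChar H 1 hθ.isCharacter.map_conj] at h
    rw [← charInner_conj_symm]
    exact h
  obtain ⟨hθ1, hker⟩ := hθ.apply_eq_of_charInner_one_ne_zero H h1
  set μ := indChar H γ with hμ_def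
  have hmul : θ * μ = θ 1 • μ := by
    ext g
    by_cases hg : g ∈ H
    · simpa using Or.inl (by simpa using hker g hg 1)
    · simp [hμ_def, indChar_apply_of_notMem H γ hg]
  rw [charInner_mul_conjChar, mul_add, charInner_add_left, charInner_add_right, hmul,
    charInner_smul_left, hμ.charInner_self_s8, mul_one, ← hmul]
  obtain ⟨a, ha⟩ := (hθ.isCharacter.mul hμ.isCharacter).exists_charInner_eq_natCast hκ
  obtain ⟨b, hb⟩ := (hθ.isCharacter.mul hκ).exists_charInner_eq_natCast (hμ.isCharacter.add hκ)
  obtain ⟨V, _, _, _, ρ, rfl⟩ := hθ.isCharacter.exists_representation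
  rw [ha, hb]
  rw [Representation.char_one] at hθ1 ⊢
  norm_cast at hθ1 ⊢
  lia

end Induced

/-- **Lemma.** Let `G` be a finite `p`-group, `χ ∈ Irr(G)`, `N ⊴ G` and `ν ∈ Irr(N)` with
`(N,ν) < (G,χ)`. Let `M/N` be a chief factor of `G` with `M ∩ G_ν = N`, and set `μ = ν^M`.
Then `μ ∈ Irr(M)`, `G_μ = G_ν M`, `(M,μ) ≤ (G,χ)`, and `Ξ((1_N)^M) ⊆ Ξ((χχ̄)_M)`. -/
theorem induced_chief_factor_inertia {p : ℕ} (hp : p.Prime)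
    (G : Type) [Group G] [Finite G] (hG : IsPGroup p G)
    (χ : G → ℂ) (hχ : IsIrrChar G χ)
    (N : Subgroup G) (hN : N.Normal) (ν : ↥N → ℂ) (hν : IsIrrChar ↥N ν)
    (hNlt : N < ⊤) (hνχ : charInner ↥N ν (resChar N χ) ≠ 0)
    (M : Subgroup G) (hcf : IsChiefFactor N M)
    (hint : M ⊓ inertia N hN ν = N)
    (μ : ↥M → ℂ) (hμdef : μ = indCharSub N M ν) :
    IsIrrChar ↥M μ ∧
    inertia M hcf.normalM μ = inertia N hN ν ⊔ M ∧
    charInner ↥M μ (resChar M χ) ≠ 0 ∧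
    constituents ↥M (indCharSub N M 1) ⊆
      constituents ↥M (resChar M (χ * conjChar χ)) := by
  have hle : N ≤ M := hcf.lt.le
  have hMn := hcf.normalM
  have hHn : (N.subgroupOf M).Normal := hN.comap M.subtype
  let e : N.subgroupOf M ≃* N := Subgroup.subgroupOfEquivOfLe hle
  have hμ : μ = indChar (N.subgroupOf M) (ν ∘ e) := hμdef
  have hν' : IsIrrChar (N.subgroupOf M) (ν ∘ e) := hν.comp_mulEquiv e
  have hstab : ∀ x : M, (ν ∘ e) ∘ MulAut.conjNormal x = ν ∘ e → x ∈ N.subgroupOf M := by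
    intro x hx
    have hmem : (x : G) ∈ M ⊓ inertia N hN ν :=
      ⟨x.2, fun n => congrFun hx (e.symm n)⟩
    rwa [hint] at hmem
  have hφ : IsCharacter M (resChar M χ) := hχ.isCharacter.comp M.subtype
  have hres : charInner (N.subgroupOf M) (ν ∘ e) (resChar _ (resChar M χ)) ≠ 0 := by
    rwa [← charInner_comp_mulEquiv e] at hνχ
  obtain ⟨hirr, κ, hκ, hsum⟩ := isIrrChar_indChar_and_exists_add _ hν' hstab hφ hres
  have hμχ : charInner M μ (resChar M χ) ≠ 0 := by
    rw [hμ, charInner_indChar _ _ hφ.map_conj]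
    exact hres
  refine ⟨hμ ▸ hirr, ?_, hμχ, ?_⟩
  · refine le_antisymm (fun g hg => ?_) (sup_le (fun g hg m => ?_) fun g hg m => ?_)
    · let c : N ≃* N := MulAut.conjNormal g
      have hc : IsIrrChar (N.subgroupOf M) ((ν ∘ c) ∘ e) := (hν.comp_mulEquiv c).comp_mulEquiv e
      have := Fintype.ofFinite M
      have hne : charInner (N.subgroupOf M) ((ν ∘ c) ∘ e) (resChar _ μ) ≠ 0 := by
        have hμc : resChar (N.subgroupOf M) μ = (resChar₂ hle μ ∘ c) ∘ e :=
          funext fun n => (hg n).symm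
        rw [hμc, charInner_comp_mulEquiv, charInner_comp_mulEquiv, ← charInner_comp_mulEquiv e]
        have h1 := hirr.charInner_self_s8
        rw [charInner_indChar _ _ (indChar_conj _ _), ← hμ] at h1
        exact fun h0 => one_ne_zero (h1.symm.trans h0)
      rw [hμ, charInner_resChar_indChar] at hne
      obtain ⟨x, -, hx⟩ := Finset.exists_ne_zero_of_sum_ne_zero (right_ne_zero_of_mul hne)
      have heq := hc.eq_of_charInner_ne_zero_s8 (hν'.comp_mulEquiv _) hx
      have hgx : g * (x : G)⁻¹ ∈ inertia N hN ν := fun n => by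
        have h := congrFun heq (e.symm (MulAut.conjNormal (x : G)⁻¹ n))
        have h2 : ν (MulAut.conjNormal g (MulAut.conjNormal (x : G)⁻¹ n)) =
          ν (MulAut.conjNormal (x : G) (MulAut.conjNormal (x : G)⁻¹ n)) := h
        rwa [← MulAut.mul_apply, ← MulAut.mul_apply, ← map_mul, ← map_mul, mul_inv_cancel,
          map_one, MulAut.one_apply] at h2
      rw [← inv_mul_cancel_right g (x : G)]
      exact mul_mem (Subgroup.mem_sup_left hgx) (Subgroup.mem_sup_right x.2)
    · rw [hμ]
      by_cases hm : m ∈ N.subgroupOf M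
      · have := Fintype.ofFinite M
        have hm' : MulAut.conjNormal g m ∈ N.subgroupOf M := by
          simpa [Subgroup.mem_subgroupOf] using hN.conj_mem _ hm g
        rw [indChar_apply_of_mem _ _ ⟨m, hm⟩, indChar_apply_of_mem _ _ ⟨_, hm'⟩]
        congr 1
        symm
        refine Fintype.sum_equiv (MulAut.conjNormal g).toEquiv _ _ fun x => ?_
        rw [Function.comp_apply, Function.comp_apply, ← hg]
        congr 1
        ext
        simp [e, mul_assoc]
      · have hm' : MulAut.conjNormal g m ∉ N.subgroupOf M := fun h => hm <| by
          simpa [Subgroup.mem_subgroupOf, mul_assoc] using hN.conj_mem _ h g⁻¹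
        rw [indChar_apply_of_notMem _ _ hm, indChar_apply_of_notMem _ _ hm']
    · rw [hμ, ← indChar_conj _ _ ⟨g, hg⟩ m]
      rfl
  · rintro θ ⟨hθ, hne⟩
    refine ⟨hθ, ?_⟩
    have := charInner_mul_conjChar_ne_zero _ hirr hκ hθ hne
    rwa [← hsum] at this
end
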